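/- For every integer n ≥ 789, (√12·π²·e^{μ(n)}/(36·μ(n)^{10}))·(μ(n)^8 − μ(n)^7 − 1) < p(n) < (√12·π²·e^{μ(n)}/(36·μ(n)^{10}))·(μ(n)^8 − μ(n)^7 + 1). -/

import Mathlib

/-- The partition function: the number of partitions of `n`. -/
def partitionFn (n : ℕ) : ℕ := Fintype.card (Nat.Partition n)

/-- `μ(n) = π √(24 n - 1) / 6`. -/
noncomputable def muP (n : ℕ) : ℝ := Real.pi * Real.sqrt (24 * (n : ℝ) - 1) / 6

/-- If the power series `φ` and `ψ` over `ℂ` converge absolutely at `q`, so does their product,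
and evaluation at `q` is multiplicative. -/
theorem PowerSeries.hasSum_coeff_mul {φ ψ : PowerSeries ℂ} {q a b : ℂ}
    (hφ : Summable fun n ↦ ‖φ.coeff n * q ^ n‖) (hψ : Summable fun n ↦ ‖ψ.coeff n * q ^ n‖)
    (ha : HasSum (fun n ↦ φ.coeff n * q ^ n) a) (hb : HasSum (fun n ↦ ψ.coeff n * q ^ n) b) :
    Summable (fun n ↦ ‖(φ * ψ).coeff n * q ^ n‖) ∧
      HasSum (fun n ↦ (φ * ψ).coeff n * q ^ n) (a * b) := by
  have key : ∀ n, (φ * ψ).coeff n * q ^ n = ∑ kl ∈ Finset.HasAntidiagonal.antidiagonal n,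
      (φ.coeff kl.1 * q ^ kl.1) * (ψ.coeff kl.2 * q ^ kl.2) := by
    intro n
    rw [PowerSeries.coeff_mul, Finset.sum_mul]
    refine Finset.sum_congr rfl fun kl hkl ↦ ?_
    rw [← Finset.HasAntidiagonal.mem_antidiagonal.mp hkl, pow_add]
    ring
  have hs := summable_norm_sum_mul_antidiagonal_of_summable_norm hφ hψ
  simp_rw [key]
  refine ⟨hs, ?_⟩
  rw [← ha.tsum_eq, ← hb.tsum_eq, tsum_mul_tsum_eq_tsum_sum_antidiagonal_of_summable_norm hφ hψ]
  exact hs.of_norm.hasSum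

/-- The geometric series in `X ^ (i + 1)`. -/
noncomputable def geomSeries (i : ℕ) : PowerSeries ℂ :=
  PowerSeries.mk fun n ↦ if i + 1 ∣ n then 1 else 0

theorem hasSum_coeff_geomSeries (i : ℕ) {q : ℂ} (hq : ‖q‖ < 1) :
    Summable (fun n ↦ ‖(geomSeries i).coeff n * q ^ n‖) ∧
      HasSum (fun n ↦ (geomSeries i).coeff n * q ^ n) (1 - q ^ (i + 1))⁻¹ := by
  constructor
  · refine Summable.of_nonneg_of_le (fun _ ↦ norm_nonneg _) (fun n ↦ ?_)
      (summable_geometric_of_lt_one (norm_nonneg q) hq)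
    rw [geomSeries, PowerSeries.coeff_mk, norm_mul, norm_pow]
    split_ifs <;> simp
  · have h1 : ‖q ^ (i + 1)‖ < 1 := by
      rw [norm_pow]; exact pow_lt_one₀ (norm_nonneg q) hq (by simp)
    have h2 := hasSum_geometric_of_norm_lt_one h1
    have hinj : Function.Injective fun m : ℕ ↦ (i + 1) * m := fun a b h ↦
      Nat.eq_of_mul_eq_mul_left i.succ_pos h
    rw [← hinj.hasSum_iff]
    · refine h2.congr_fun fun m ↦ ?_
      simp [geomSeries, pow_mul]
    · intro n hn
      have : ¬ (i + 1 ∣ n) := fun ⟨m, hm⟩ ↦ hn ⟨m, hm.symm⟩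
      simp [geomSeries, this]

/-- The number of partitions of `n` with all parts at most `N`. -/
def boundedPartitionFn (N n : ℕ) : ℕ := (Nat.Partition.restricted n (· ≤ N)).card


theorem one_sub_X_pow_mul_geomSeries (i : ℕ) :
    (1 - PowerSeries.X ^ (i + 1)) * geomSeries i = 1 := by
  ext n
  rw [sub_mul, one_mul, map_sub, PowerSeries.coeff_X_pow_mul', PowerSeries.coeff_one]
  simp only [geomSeries, PowerSeries.coeff_mk]
  by_cases h : i + 1 ≤ n
  · have : i + 1 ∣ n - (i + 1) ↔ i + 1 ∣ n := by
      obtain ⟨m, rfl⟩ := Nat.exists_eq_add_of_le h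
      simp
    simp only [if_pos h, this, sub_self]
    rw [if_neg (by omega)]
  · rw [if_neg h, sub_zero]
    rcases Nat.eq_zero_or_pos n with rfl | hn
    · simp
    · rw [if_neg (fun hd ↦ h (Nat.le_of_dvd hn hd)), if_neg hn.ne']

open scoped PowerSeries.WithPiTopology in
theorem mk_boundedPartitionFn_eq_prod (N : ℕ) :
    PowerSeries.mk (fun n ↦ (boundedPartitionFn N n : ℂ)) =
      ∏ i ∈ Finset.range N, geomSeries i := by
  let _ : TopologicalSpace ℂ := ⊥
  have : DiscreteTopology ℂ := ⟨rfl⟩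
  have h := Nat.Partition.powerSeriesMk_card_restricted_eq_tprod ℂ (· ≤ N)
  simp only [boundedPartitionFn]
  rw [h, tprod_eq_prod (s := Finset.range N)]
  · refine Finset.prod_congr rfl fun i hi ↦ ?_
    rw [if_pos (by simpa using hi)]
    simp_rw [pow_mul]
    exact left_inv_eq_right_inv
      (PowerSeries.WithPiTopology.tsum_pow_mul_one_sub_of_constantCoeff_eq_zero (by simp))
      (one_sub_X_pow_mul_geomSeries i)
  · intro i hi
    rw [if_neg (by simpa using hi)]

theorem hasSum_boundedPartitionFn (N : ℕ) {q : ℂ} (hq : ‖q‖ < 1) :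
    HasSum (fun n ↦ (boundedPartitionFn N n : ℂ) * q ^ n)
      (∏ i ∈ Finset.range N, (1 - q ^ (i + 1))⁻¹) := by
  have key : Summable (fun n ↦ ‖(∏ i ∈ Finset.range N, geomSeries i).coeff n * q ^ n‖) ∧
      HasSum (fun n ↦ (∏ i ∈ Finset.range N, geomSeries i).coeff n * q ^ n)
        (∏ i ∈ Finset.range N, (1 - q ^ (i + 1))⁻¹) := by
    induction N with
    | zero =>
      have h0 : ∀ n ≠ 0, (1 : PowerSeries ℂ).coeff n * q ^ n = 0 := by
        intro n hn; simp [PowerSeries.coeff_one, hn]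
      simp only [Finset.range_zero, Finset.prod_empty]
      constructor
      · exact summable_of_ne_finset_zero (s := {0}) fun n hn ↦ by
          rw [h0 n (by simpa using hn), norm_zero]
      · simpa using hasSum_single 0 h0
    | succ N ih =>
      obtain ⟨h1, h2⟩ := hasSum_coeff_geomSeries N hq
      rw [Finset.prod_range_succ, Finset.prod_range_succ]
      exact PowerSeries.hasSum_coeff_mul ih.1 h1 ih.2 h2
  rw [← mk_boundedPartitionFn_eq_prod] at key
  simpa only [PowerSeries.coeff_mk] using key.2

theorem boundedPartitionFn_le (N n : ℕ) : boundedPartitionFn N n ≤ partitionFn n :=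
  Finset.card_le_univ _

theorem boundedPartitionFn_eq {N n : ℕ} (h : n ≤ N) : boundedPartitionFn N n = partitionFn n := by
  rw [boundedPartitionFn, partitionFn, ← Finset.card_univ, Nat.Partition.restricted,
    Finset.filter_true_of_mem]
  exact fun p _ i hi ↦ (p.le_of_mem_parts hi).trans h

theorem tprod_one_sub_pow_ne_zero {q : ℂ} (hq : ‖q‖ < 1) : ∏' n : ℕ, (1 - q ^ (n + 1)) ≠ 0 := by
  simp only [sub_eq_add_neg]
  refine tprod_one_add_ne_zero_of_summable (fun n h ↦ ?_) ?_
  · have h1 : q ^ (n + 1) = 1 := by linear_combination -h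
    have h2 : ‖q ^ (n + 1)‖ < 1 := by
      rw [norm_pow]; exact pow_lt_one₀ (norm_nonneg q) hq (by simp)
    simp [h1] at h2
  · simpa using (summable_nat_add_iff 1).mpr (summable_geometric_of_lt_one (norm_nonneg _) hq)

theorem tendsto_prod_inv_one_sub_pow {q : ℂ} (hq : ‖q‖ < 1) :
    Filter.Tendsto (fun N ↦ ∏ i ∈ Finset.range N, (1 - q ^ (i + 1))⁻¹) Filter.atTop
      (nhds (∏' n : ℕ, (1 - q ^ (n + 1)))⁻¹) := by
  have h := (ModularForm.multipliable_one_sub_pow hq).hasProd.tendsto_prod_nat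
  simpa only [Finset.prod_inv_distrib] using h.inv₀ (tprod_one_sub_pow_ne_zero hq)

theorem summable_partitionFn {r : ℝ} (h0 : 0 ≤ r) (h1 : r < 1) :
    Summable fun n ↦ (partitionFn n : ℝ) * r ^ n := by
  have hr : ‖(r : ℂ)‖ < 1 := by simpa [abs_of_nonneg h0] using h1
  obtain ⟨C, hC⟩ := (Metric.isBounded_range_of_tendsto _
    (tendsto_prod_inv_one_sub_pow hr)).exists_norm_le
  refine summable_of_sum_range_le (c := C) (fun n ↦ by positivity) fun N ↦ ?_
  have hs := hasSum_boundedPartitionFn N hr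
  have hb := hC _ ⟨N, rfl⟩
  have hre : HasSum (fun n ↦ (boundedPartitionFn N n : ℝ) * r ^ n)
      (∏ i ∈ Finset.range N, (1 - (r : ℂ) ^ (i + 1))⁻¹).re := by
    convert Complex.hasSum_re hs using 2 with n
    norm_cast
  calc ∑ n ∈ Finset.range N, (partitionFn n : ℝ) * r ^ n
      = ∑ n ∈ Finset.range N, (boundedPartitionFn N n : ℝ) * r ^ n :=
        Finset.sum_congr rfl fun n hn ↦ by
          rw [boundedPartitionFn_eq (Finset.mem_range.mp hn).le]
    _ ≤ _ := sum_le_hasSum _ (fun n _ ↦ by positivity) hre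
    _ ≤ C := (Complex.re_le_norm _).trans hb

/-- Euler's generating function of the partition numbers. -/
theorem hasSum_partitionFn {q : ℂ} (hq : ‖q‖ < 1) :
    HasSum (fun n ↦ (partitionFn n : ℂ) * q ^ n) (∏' n : ℕ, (1 - q ^ (n + 1)))⁻¹ := by
  have hsum := summable_partitionFn (norm_nonneg q) hq
  have hlim := tendsto_tsum_of_dominated_convergence (𝓕 := Filter.atTop)
    (f := fun N n ↦ (boundedPartitionFn N n : ℂ) * q ^ n)
    (g := fun n ↦ (partitionFn n : ℂ) * q ^ n) hsum
    (fun n ↦ tendsto_const_nhds.congr' <| by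
      filter_upwards [Filter.eventually_ge_atTop n] with N hN
      rw [boundedPartitionFn_eq hN])
    (Filter.Eventually.of_forall fun N n ↦ by
      rw [norm_mul, norm_pow, Complex.norm_natCast]
      gcongr
      exact boundedPartitionFn_le N n)
  simp_rw [(hasSum_boundedPartitionFn _ hq).tsum_eq] at hlim
  rw [tendsto_nhds_unique (tendsto_prod_inv_one_sub_pow hq) hlim]
  refine Summable.hasSum (Summable.of_norm ?_)
  simpa using hsum

theorem partitionFn_le (n : ℕ) : partitionFn n ≤ 2 ^ (n - 1) := by
  rw [← composition_card]
  exact Fintype.card_le_of_surjective _ Nat.Partition.ofComposition_surj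

theorem norm_inv_tprod_one_sub_pow_sub_one_le {q : ℂ} (hq : ‖q‖ < 1 / 2) :
    ‖(∏' n : ℕ, (1 - q ^ (n + 1)))⁻¹ - 1‖ ≤ ‖q‖ / (1 - 2 * ‖q‖) := by
  have h := (hasSum_nat_add_iff' 1).mpr (hasSum_partitionFn (q := q) (by linarith))
  have h0 : partitionFn 0 = 1 := by simp [partitionFn]
  simp only [Finset.sum_range_one, h0, Nat.cast_one, pow_zero, mul_one] at h
  have hg := (hasSum_geometric_of_lt_one (r := 2 * ‖q‖) (by positivity) (by linarith)).mul_left ‖q‖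
  rw [← h.tsum_eq, div_eq_mul_inv]
  refine tsum_of_norm_bounded hg fun n ↦ ?_
  rw [norm_mul, norm_pow, Complex.norm_natCast, pow_succ, mul_pow]
  have : (partitionFn (n + 1) : ℝ) ≤ 2 ^ n := by exact_mod_cast partitionFn_le (n + 1)
  calc _ ≤ 2 ^ n * (‖q‖ ^ n * ‖q‖) := by gcongr
    _ = _ := by ring

open ModularForm Complex in
theorem inv_eta_eq {z : ℂ} :
    (eta z)⁻¹ = cexp (-(Real.pi * I * z / 12)) *
      (∏' n : ℕ, (1 - cexp (2 * Real.pi * I * z) ^ (n + 1)))⁻¹ := by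
  rw [ModularForm.eta, mul_inv, Function.Periodic.qParam, ← Complex.exp_neg]
  congr 2
  · push_cast; ring
  · simp [eta_q, Function.Periodic.qParam]

open Complex in
theorem norm_exp_two_pi_I_mul (z : ℂ) :
    ‖cexp (2 * Real.pi * I * z)‖ = Real.exp (-(2 * Real.pi * z.im)) := by
  rw [Complex.norm_exp]; simp

open Complex in
theorem norm_exp_neg_two_pi_I_mul_real (c x y : ℝ) :
    ‖cexp (-(2 * Real.pi * I * c * (x + y * I)))‖ = Real.exp (2 * Real.pi * c * y) := by
  rw [Complex.norm_exp]; simp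

open Complex in
theorem integral_exp_two_pi_I_mul (m : ℤ) :
    ∫ x : ℝ in (-(1 / 2))..(1 / 2), cexp (2 * Real.pi * I * m * x) = if m = 0 then 1 else 0 := by
  split_ifs with h
  · simp [h]; norm_num
  · rw [integral_exp_mul_complex (by simp [h, Real.pi_ne_zero])]
    have : cexp (2 * Real.pi * I * m * ((1 / 2 : ℝ) : ℂ)) =
        cexp (2 * Real.pi * I * m * ((-(1 / 2) : ℝ) : ℂ)) := by
      rw [Complex.exp_eq_exp_iff_exists_int]
      exact ⟨m, by push_cast; ring⟩
    rw [this, sub_self, zero_div]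

open ModularForm Complex in
/-- The partition number `p(n)` as a Fourier coefficient of `1 / η`. -/
theorem partitionFn_eq_integral (n : ℕ) {y : ℝ} (hy : 0 < y) :
    ∫ x : ℝ in (-(1 / 2))..(1 / 2), (eta (x + y * I))⁻¹ *
      cexp (-(2 * Real.pi * I * (n - 1 / 24 : ℝ) * (x + y * I))) = (partitionFn n : ℂ) := by
  set r : ℝ := Real.exp (-(2 * Real.pi * y)) with hr
  have hr1 : r < 1 := Real.exp_lt_one_iff.2 (by have := Real.pi_pos; nlinarith)
  have hq (x : ℝ) : ‖cexp (2 * Real.pi * I * (x + y * I))‖ = r := by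
    rw [norm_exp_two_pi_I_mul]; simp [hr]
  let F (m : ℕ) (x : ℝ) : ℂ := (partitionFn m : ℂ) * cexp (2 * Real.pi * I * (x + y * I)) ^ m *
      cexp (-(2 * Real.pi * I * n * (x + y * I)))
  have hF (x : ℝ) : HasSum (fun m ↦ F m x) ((eta (x + y * I))⁻¹ *
      cexp (-(2 * Real.pi * I * (n - 1 / 24 : ℝ) * (x + y * I)))) := by
    have := (hasSum_partitionFn (q := cexp (2 * Real.pi * I * (x + y * I)))
      (by rw [hq]; exact hr1)).mul_right (cexp (-(2 * Real.pi * I * n * (x + y * I))))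
    convert! this using 1
    rw [inv_eta_eq, mul_right_comm, ← Complex.exp_add, mul_comm]
    congr 2
    push_cast
    ring
  have hFn (m : ℕ) (x : ℝ) : ‖F m x‖ = partitionFn m * r ^ m * Real.exp (2 * Real.pi * n * y) := by
    simp only [F, norm_mul, norm_pow, hq, Complex.norm_natCast]
    rw [← norm_exp_neg_two_pi_I_mul_real n x y]
    simp
  have hsum := intervalIntegral.hasSum_integral_of_dominated_convergence (μ := MeasureTheory.volume)
    (a := -(1 / 2)) (b := 1 / 2) (F := F)
    (bound := fun m _ ↦ partitionFn m * r ^ m * Real.exp (2 * Real.pi * n * y))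
    (fun m ↦ (by fun_prop : Continuous (F m)).aestronglyMeasurable)
    (fun m ↦ Filter.Eventually.of_forall fun x _ ↦ (hFn m x).le)
    (Filter.Eventually.of_forall fun x _ ↦
      ((summable_partitionFn (Real.exp_pos _).le hr1).mul_right _))
    (by simp)
    (Filter.Eventually.of_forall fun x _ ↦ hF x)
  have hInt (m : ℕ) : ∫ x : ℝ in (-(1 / 2))..(1 / 2), F m x =
        if m = n then (partitionFn n : ℂ) else 0 := by
    have h1 (x : ℝ) : F m x = (partitionFn m * cexp (-(2 * Real.pi * ((m : ℂ) - n) * y))) *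
        cexp (2 * Real.pi * I * ((m - n : ℤ) : ℂ) * x) := by
      simp only [F]
      rw [← Complex.exp_nat_mul, mul_assoc (partitionFn m : ℂ), mul_assoc (partitionFn m : ℂ),
        ← Complex.exp_add, ← Complex.exp_add]
      congr 2
      push_cast
      linear_combination (2 * Real.pi * ((m : ℂ) - n) * y) * I_sq
    simp_rw [h1]
    rw [intervalIntegral.integral_const_mul, integral_exp_two_pi_I_mul]
    by_cases h : m = n
    · simp [h]
    · rw [if_neg h, if_neg (by omega), mul_zero]
  simp_rw [hInt] at hsum
  exact hsum.unique (hasSum_ite_eq n _)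

open ModularForm Complex in
theorem inv_eta_eq_cpow_mul {z : ℂ} (hz : 0 < z.im) :
    (eta z)⁻¹ = (z / I) ^ (1 / 2 : ℂ) * (eta (-1 / z))⁻¹ := by
  have hz0 : z ≠ 0 := fun h ↦ by simp [h] at hz
  have h := eta_comp_eq_csqrt_I_inv (show z ∈ UpperHalfPlane.upperHalfPlaneSet from hz)
  simp only [Function.comp_apply, Pi.smul_apply, Pi.mul_apply, smul_eq_mul] at h
  have hs : sqrt z = (z / I) ^ (1 / 2 : ℂ) * sqrt I := by
    have hzI : z / I ≠ 0 := div_ne_zero hz0 I_ne_zero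
    have harg : |arg (z / I)| < Real.pi / 2 := by
      rw [Complex.abs_arg_lt_pi_div_two_iff]
      left
      simpa [div_I] using hz
    have hlog : log z = log (z / I) + log I := by
      rw [← (Complex.log_mul_eq_add_log_iff hzI I_ne_zero).2, div_mul_cancel₀ _ I_ne_zero]
      rw [arg_I]
      obtain ⟨h1, h2⟩ := abs_lt.1 harg
      constructor <;> linarith [Real.pi_pos]
    rw [sqrt_eq_exp hz0, sqrt_eq_exp I_ne_zero, cpow_def_of_ne_zero hzI, ← Complex.exp_add, hlog]
    congr 1
    ring
  have hI : sqrt I ≠ 0 := by rw [sqrt_eq_exp I_ne_zero]; exact Complex.exp_ne_zero _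
  have h0 : (z / I) ^ (1 / 2 : ℂ) ≠ 0 := by simp [cpow_eq_zero_iff, hz0]
  rw [h, hs]
  field_simp

open ModularForm Complex MatrixGroups UpperHalfPlane in
/-- The function `|η|⁴ · Im` is invariant under `SL(2, ℤ)` (here raised to the sixth power). -/
theorem norm_eta_smul (g : SL(2, ℤ)) (z : ℍ) :
    ‖ModularForm.eta (g • z : ℍ)‖ ^ 24 * (g • z).im ^ 6 = ‖ModularForm.eta z‖ ^ 24 * z.im ^ 6 := by
  have h := SlashInvariantFormClass.norm_petersson_smul (k := 12) (g := (g : GL (Fin 2) ℝ))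
    (f := CuspForm.discriminant) (f' := CuspForm.discriminant) (Γ := 𝒮ℒ) ⟨g, rfl⟩ (τ := z)
  simp only [petersson, CuspForm.coe_discriminant, ModularForm.discriminant, norm_mul,
    RCLike.norm_conj, norm_pow] at h
  change ‖ModularForm.eta (g • z : ℍ)‖ ^ 24 * ‖ModularForm.eta (g • z : ℍ)‖ ^ 24 *
    ‖(((g • z : ℍ).im : ℂ)) ^ (12 : ℤ)‖ = _ * ‖((z.im : ℂ)) ^ (12 : ℤ)‖ at h
  simp only [norm_zpow, norm_real, Real.norm_eq_abs, abs_of_pos (UpperHalfPlane.im_pos _)] at h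
  norm_cast at h
  have h1 := (g • z).im_pos
  have h2 := z.im_pos
  rw [← pow_left_inj₀ (by positivity) (by positivity) two_ne_zero]
  linarith

theorem exp_neg_pi_le : Real.exp (-Real.pi) ≤ 1 / 20 := by
  have h1 : Real.exp (-Real.pi) ≤ Real.exp (-3) :=
    Real.exp_le_exp.2 (by linarith [Real.pi_gt_three])
  have h2 : Real.exp (-3) = (Real.exp 1 ^ 3)⁻¹ := by
    rw [← Real.exp_nat_mul, ← Real.exp_neg]; norm_num
  have h3 : (20 : ℝ) ≤ Real.exp 1 ^ 3 := by
    have := Real.exp_one_gt_d9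
    calc (20 : ℝ) ≤ 2.7182818283 ^ 3 := by norm_num
      _ ≤ _ := by gcongr
  rw [h2] at h1
  refine h1.trans ?_
  rw [one_div]
  gcongr

theorem exp_neg_five_le : Real.exp (-5) ≤ 1 / 140 := by
  have h2 : Real.exp (-5) = (Real.exp 1 ^ 5)⁻¹ := by
    rw [← Real.exp_nat_mul, ← Real.exp_neg]; norm_num
  have h3 : (140 : ℝ) ≤ Real.exp 1 ^ 5 := by
    have := Real.exp_one_gt_d9
    calc (140 : ℝ) ≤ 2.7182818283 ^ 5 := by norm_num
      _ ≤ _ := by gcongr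
  rw [h2, one_div]
  gcongr

open Complex in
theorem norm_inv_eta_sub_le {w : ℂ} (hw : 1 / 2 ≤ w.im) :
    ‖(ModularForm.eta w)⁻¹ - cexp (-(Real.pi * I * w / 12))‖ ≤ 1 := by
  have hq := norm_exp_two_pi_I_mul w
  set q := cexp (2 * Real.pi * I * w)
  have hpi := Real.pi_gt_three
  have hq1 : ‖q‖ ≤ 1 / 20 := by
    rw [hq]
    exact (Real.exp_le_exp.2 (by nlinarith)).trans exp_neg_pi_le
  have hP := norm_inv_tprod_one_sub_pow_sub_one_le (q := q) (by linarith)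
  rw [inv_eta_eq]
  change ‖_ * (∏' n : ℕ, (1 - q ^ (n + 1)))⁻¹ - _‖ ≤ 1
  rw [show ∀ a b : ℂ, a * b - a = a * (b - 1) from fun a b ↦ by ring, norm_mul, Complex.norm_exp]
  have h1 : (-(Real.pi * I * w / 12)).re = Real.pi * w.im / 12 := by
    simp; ring
  rw [h1]
  calc _ ≤ Real.exp (Real.pi * w.im / 12) * (‖q‖ / (1 / 2)) := by
        refine mul_le_mul_of_nonneg_left (hP.trans ?_) (Real.exp_pos _).le
        gcongr
        linarith
    _ = 2 * Real.exp (-(23 / 12 * Real.pi * w.im)) := by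
        rw [hq, mul_div_assoc', ← Real.exp_add]
        rw [show Real.pi * w.im / 12 + -(2 * Real.pi * w.im) = -(23 / 12 * Real.pi * w.im) by ring]
        ring
    _ ≤ 2 * Real.exp (-1) := by
        gcongr
        nlinarith
    _ ≤ 1 := by
        rw [Real.exp_neg]
        have : (2 : ℝ) ≤ Real.exp 1 := by linarith [Real.exp_one_gt_d9]
        have := inv_anti₀ (by norm_num) this
        linarith

open Complex in
theorem norm_inv_eta_le {w : ℂ} (hw : 4 / 5 ≤ w.im) :
    ‖(ModularForm.eta w)⁻¹‖ ≤ 101 / 100 * Real.exp (Real.pi * w.im / 12) := by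
  have hq := norm_exp_two_pi_I_mul w
  set q := cexp (2 * Real.pi * I * w)
  have hpi := Real.pi_gt_d2
  have hq1 : ‖q‖ ≤ 1 / 140 := by
    rw [hq]
    exact (Real.exp_le_exp.2 (by nlinarith)).trans exp_neg_five_le
  have hP := norm_inv_tprod_one_sub_pow_sub_one_le (q := q) (by linarith)
  rw [inv_eta_eq]
  change ‖_ * (∏' n : ℕ, (1 - q ^ (n + 1)))⁻¹‖ ≤ _
  rw [norm_mul, Complex.norm_exp, mul_comm]
  have h1 : (-(Real.pi * I * w / 12)).re = Real.pi * w.im / 12 := by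
    simp; ring
  rw [h1]
  gcongr
  have h2 : ‖q‖ / (1 - 2 * ‖q‖) ≤ 1 / 100 := by
    rw [div_le_iff₀ (by linarith)]; linarith
  have h3 := norm_le_norm_add_norm_sub (1 : ℂ) (∏' n : ℕ, (1 - q ^ (n + 1)))⁻¹
  rw [norm_one] at h3
  rw [norm_sub_rev] at hP
  have h4 : ‖(1 : ℂ) - (∏' n : ℕ, (1 - q ^ (n + 1)))⁻¹‖ ≤ 1 / 100 := hP.trans h2
  have h5 := norm_sub_norm_le ((∏' n : ℕ, (1 - q ^ (n + 1)))⁻¹) 1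
  rw [norm_one, norm_sub_rev] at h5
  linarith

open Complex MatrixGroups UpperHalfPlane in
theorem norm_inv_eta_le_of_smul {z : ℍ} {g : SL(2, ℤ)} (hg : 4 / 5 ≤ (g • z).im) {β : ℝ}
    (hβ0 : 0 ≤ β) (hβ : z.im / (g • z).im ≤ β ^ 4) :
    ‖(ModularForm.eta z)⁻¹‖ ≤ β * (101 / 100 * Real.exp (Real.pi * (g • z).im / 12)) := by
  have h1 := norm_inv_eta_le (w := (g • z : ℍ)) hg
  refine le_trans ?_ (mul_le_mul_of_nonneg_left h1 hβ0)
  have h := norm_eta_smul g z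
  have hz := z.im_pos
  have hgz := (g • z).im_pos
  have e1 : 0 < ‖ModularForm.eta z‖ := norm_pos_iff.2 (ModularForm.eta_ne_zero z.im_pos)
  have e2 : 0 < ‖ModularForm.eta (g • z : ℍ)‖ :=
    norm_pos_iff.2 (ModularForm.eta_ne_zero (g • z).im_pos)
  rw [← pow_le_pow_iff_left₀ (by positivity) (by positivity) (show 24 ≠ 0 by norm_num), mul_pow,
    norm_inv, norm_inv, inv_pow, inv_pow]
  have h2 : (‖ModularForm.eta z‖ ^ 24)⁻¹ =
      (z.im / (g • z).im) ^ 6 * (‖ModularForm.eta (g • z : ℍ)‖ ^ 24)⁻¹ := by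
    rw [div_pow]
    field_simp
    linarith
  rw [h2, show β ^ 24 = (β ^ 4) ^ 6 by ring]
  gcongr

theorem quadratic_form_lower_bound {a b c d : ℤ} (hdet : a * d - b * c = 1) {x y : ℝ}
    (hx : |x| ≤ 1 / 2) (hy : 0 < y) (hy1 : y < 1 / 5)
    (h : y / (x ^ 2 + y ^ 2) < 1 / 2) (hv : 4 / 5 ≤ y / ((c * x + d) ^ 2 + (c * y) ^ 2)) :
    4 * (1 / 2 - |x|) ^ 2 + 4 * y ^ 2 ≤ (c * x + d) ^ 2 + (c * y) ^ 2 ∨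
      9 * y ^ 2 ≤ (c * x + d) ^ 2 + (c * y) ^ 2 := by
  have hDpos : 0 < (c * x + d) ^ 2 + (c * y) ^ 2 := by
    by_contra! hD0
    linarith [div_nonpos_of_nonneg_of_nonpos hy.le hD0]
  rw [le_div_iff₀ hDpos] at hv
  rw [div_lt_iff₀ (by positivity)] at h
  have hx2 := abs_le.1 hx
  have hInt (e : ℤ) (he : e ≠ 0) : (1 : ℝ) ≤ |(e : ℝ)| := by
    exact_mod_cast Int.one_le_abs he
  have hdx : |(d : ℝ)| - |(c : ℝ)| * |x| ≤ |c * x + d| := by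
    have := abs_sub_abs_le_abs_sub (d : ℝ) (-(c * x))
    rw [abs_neg, abs_mul, sub_neg_eq_add, add_comm (d : ℝ)] at this
    exact this
  by_cases hc3 : 3 ≤ |c|
  · right
    have : (3 : ℝ) ≤ |(c : ℝ)| := by exact_mod_cast hc3
    have : 9 ≤ (c : ℝ) ^ 2 := by rw [← sq_abs]; nlinarith
    nlinarith [sq_nonneg (c * x + d)]
  by_cases hc0 : c = 0
  · subst hc0
    exfalso
    have hd0 : d ≠ 0 := by rintro rfl; simp at hdet
    have := hInt d hd0
    have : 1 ≤ (d : ℝ) ^ 2 := by rw [← sq_abs]; nlinarith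
    push_cast at hv
    nlinarith
  by_cases hc1 : |c| = 1
  · exfalso
    have hc1' : |(c : ℝ)| = 1 := by exact_mod_cast hc1
    have hcsq : (c : ℝ) ^ 2 = 1 := by rw [← sq_abs, hc1']; norm_num
    by_cases hd0 : d = 0
    · subst hd0
      push_cast at hv
      nlinarith
    · have := hInt d hd0
      rw [hc1', one_mul] at hdx
      have h1 : 1 / 2 ≤ |c * x + d| := by linarith
      have : 1 / 4 ≤ (c * x + d) ^ 2 := by rw [← sq_abs]; nlinarith
      nlinarith
  · left
    have hc2 : |c| = 2 := by
      have := Int.one_le_abs hc0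
      omega
    have hc2' : |(c : ℝ)| = 2 := by exact_mod_cast hc2
    have hcsq : (c : ℝ) ^ 2 = 4 := by rw [← sq_abs, hc2']; norm_num
    have hd0 : d ≠ 0 := by
      rintro rfl
      have h2 : (2 : ℤ) ∣ c := by rw [← dvd_abs, hc2]
      have : (2 : ℤ) ∣ 1 := by
        rw [← hdet]
        simpa using Dvd.dvd.mul_left h2 b
      omega
    have := hInt d hd0
    rw [hc2'] at hdx
    have h1 : 2 * (1 / 2 - |x|) ≤ |c * x + d| := by linarith
    have : (2 * (1 / 2 - |x|)) ^ 2 ≤ (c * x + d) ^ 2 := by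
      rw [← sq_abs (c * x + d)]
      gcongr
    nlinarith

open Complex MatrixGroups UpperHalfPlane in
/-- A bound for `|1 / η|` off the leading arc. -/
theorem norm_inv_eta_le_of_im_inv_lt {x y : ℝ} (hx : |x| ≤ 1 / 2) (hy : 0 < y)
    (hy1 : y ≤ 91 / 25000) (h : y / (x ^ 2 + y ^ 2) < 1 / 2) :
    ‖(ModularForm.eta (x + y * Complex.I))⁻¹‖ ≤
      26 / 100 * (101 / 100 * Real.exp (25 * Real.pi / (1968 * y))) +
      if 1 / 2 - |x| < 4 / 5 * y then 97 / 1000 * (101 / 100 * Real.exp (Real.pi / (48 * y)))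
      else 0 := by
  let z : ℍ := ⟨x + y * Complex.I, by simpa using hy⟩
  have hzim : z.im = y := by simp [z, UpperHalfPlane.im]
  have hzre : z.re = x := by simp [z, UpperHalfPlane.re]
  obtain ⟨g, hg⟩ := ModularGroup.exists_smul_mem_fd z
  have hg1 := ModularGroup.three_le_four_mul_im_sq_of_mem_fd hg
  have hgpos := (g • z).im_pos
  have hv : 4 / 5 ≤ (g • z).im := by nlinarith
  have him := ModularGroup.im_smul_eq_div_normSq g z
  set v := (g • z).im with hvdef
  set c := g 1 0 with hc
  set d := g 1 1 with hd
  have hdet := Matrix.SpecialLinearGroup.det_coe g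
  rw [Matrix.det_fin_two, ← hc, ← hd] at hdet
  have hD : normSq (denom g z) = (c * x + d) ^ 2 + (c * y) ^ 2 := by
    rw [ModularGroup.denom_apply, ← hc, ← hd, normSq_apply]
    simp [z]
    ring
  rw [hD, hzim] at him
  have hDpos : 0 < (c * x + d) ^ 2 + (c * y) ^ 2 := by
    by_contra! hD0
    rw [him] at hgpos
    exact absurd hgpos (not_lt.2 (div_nonpos_of_nonneg_of_nonpos hy.le hD0))
  have hlow := quadratic_form_lower_bound hdet hx hy (by linarith) h (him ▸ hv)
  have hvD : v * ((c * x + d) ^ 2 + (c * y) ^ 2) = y := by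
    rw [him, div_mul_cancel₀ _ hDpos.ne']
  have key (β : ℝ) (hβ0 : 0 ≤ β) (hβ : y / v ≤ β ^ 4) := norm_inv_eta_le_of_smul (z := z) hv hβ0
    (by rwa [← hvdef, hzim])
  rw [← hvdef] at key
  have hpi := Real.pi_pos
  by_cases hv1 : v ≤ 25 / (164 * y)
  · have h1 := key (26 / 100) (by norm_num) (by
      rw [div_le_iff₀ hgpos]; linarith)
    have h2 : 0 ≤ if 1 / 2 - |x| < 4 / 5 * y then
      97 / 1000 * (101 / 100 * Real.exp (Real.pi / (48 * y))) else 0 := by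
      split_ifs <;> positivity
    have h3 : Real.pi * v / 12 ≤ 25 * Real.pi / (1968 * y) := by
      calc _ ≤ Real.pi * (25 / (164 * y)) / 12 := by gcongr
        _ = _ := by field_simp; norm_num
    have h4 := Real.exp_le_exp.2 h3
    change ‖(ModularForm.eta z)⁻¹‖ ≤ _
    linarith
  · push Not at hv1
    rw [div_lt_iff₀ (by positivity)] at hv1
    have hx0 := abs_nonneg x
    have hu : 4 * (1 / 2 - |x|) ^ 2 + 4 * y ^ 2 ≤ (c * x + d) ^ 2 + (c * y) ^ 2 := by
      rcases hlow with h1 | h1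
      · exact h1
      · nlinarith
    have hu1 : 1 / 2 - |x| < 4 / 5 * y := by
      by_contra! h1
      nlinarith
    have hv2 : v * (4 * y) ≤ 1 := by
      have : v * (4 * y ^ 2) ≤ y := by nlinarith [sq_nonneg (1 / 2 - |x|)]
      nlinarith
    have h1 := key (97 / 1000) (by norm_num) (by
      rw [div_le_iff₀ hgpos]; nlinarith)
    rw [if_pos hu1]
    have h3 : Real.pi * v / 12 ≤ Real.pi / (48 * y) := by
      rw [le_div_iff₀ (by positivity)]
      nlinarith
    have h4 := Real.exp_le_exp.2 h3
    have h5 := Real.exp_pos (25 * Real.pi / (1968 * y))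
    change ‖(ModularForm.eta z)⁻¹‖ ≤ _
    linarith

theorem im_neg_one_div (x y : ℝ) :
    (-1 / ((x : ℂ) + y * Complex.I)).im = y / (x ^ 2 + y ^ 2) := by
  rw [neg_div, one_div, Complex.neg_im, Complex.inv_im, Complex.normSq_apply]
  simp
  ring

open Complex in
/-- Comparison of `1 / η` with the leading term of its expansion at the cusp `0`. -/
theorem norm_inv_eta_sub_le_of_abs_le {x y : ℝ} (hx : |x| ≤ 1 / 2) (hy : 0 < y)
    (hy1 : y ≤ 91 / 25000) :
    ‖(ModularForm.eta (x + y * I))⁻¹ - ((x + y * I) / I) ^ (1 / 2 : ℂ) *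
        cexp (Real.pi * I / (12 * (x + y * I)))‖ ≤
      26 / 100 * (101 / 100 * Real.exp (25 * Real.pi / (1968 * y))) + 2 +
      if 1 / 2 - |x| < 4 / 5 * y then 97 / 1000 * (101 / 100 * Real.exp (Real.pi / (48 * y)))
      else 0 := by
  have hzim : (x + y * I : ℂ).im = y := by simp
  have hz0 : (x + y * I : ℂ) ≠ 0 := fun h ↦ by simp [h] at hzim; linarith
  have him := im_neg_one_div x y
  have hx2 : x ^ 2 ≤ 1 / 4 := by rw [← sq_abs]; nlinarith [abs_nonneg x]
  have hpi := Real.pi_pos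
  have hsqrt : ‖((x + y * I) / I : ℂ) ^ (1 / 2 : ℂ)‖ ≤ 1 := by
    rw [show (1 / 2 : ℂ) = ((1 / 2 : ℝ) : ℂ) by push_cast; rfl,
      Complex.norm_cpow_real]
    refine Real.rpow_le_one (norm_nonneg _) ?_ (by norm_num)
    rw [norm_div, norm_I, div_one]
    refine abs_le_of_sq_le_sq' ?_ zero_le_one |>.2
    rw [← Complex.normSq_eq_norm_sq, Complex.normSq_apply]
    simp
    nlinarith
  have hexp : Real.pi * I / (12 * (x + y * I)) = -(Real.pi * I * (-1 / (x + y * I)) / 12) := by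
    field_simp
  have hite : 0 ≤ if 1 / 2 - |x| < 4 / 5 * y then
      97 / 1000 * (101 / 100 * Real.exp (Real.pi / (48 * y))) else 0 := by
    split_ifs <;> positivity
  have hE := Real.exp_pos (25 * Real.pi / (1968 * y))
  rw [hexp]
  by_cases hv : 1 / 2 ≤ y / (x ^ 2 + y ^ 2)
  · have h1 := norm_inv_eta_sub_le (him ▸ hv)
    rw [inv_eta_eq_cpow_mul (by rw [hzim]; exact hy), ← mul_sub, norm_mul]
    have : ‖((x + y * I) / I : ℂ) ^ (1 / 2 : ℂ)‖ * ‖(ModularForm.eta (-1 / (x + y * I)))⁻¹ -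
        cexp (-(Real.pi * I * (-1 / (x + y * I)) / 12))‖ ≤ 1 * 1 := by gcongr
    linarith
  · push Not at hv
    have h1 := norm_inv_eta_le_of_im_inv_lt hx hy hy1 hv
    have h2 : ‖cexp (-(Real.pi * I * (-1 / (x + y * I)) / 12))‖ ≤ 2 := by
      have hre : (-(Real.pi * I * (-1 / (x + y * I)) / 12)).re =
          Real.pi * (-1 / (x + y * I) : ℂ).im / 12 := by
        generalize (-1 / (x + y * I) : ℂ) = w
        simp; ring
      rw [norm_exp, hre, him]
      have h3 : Real.pi * (y / (x ^ 2 + y ^ 2)) / 12 ≤ 1 / 2 := by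
        have := Real.pi_lt_four
        have : 0 ≤ y / (x ^ 2 + y ^ 2) := by positivity
        nlinarith
      refine (Real.exp_le_exp.2 h3).trans ?_
      have h4 : Real.exp (1 / 2) ^ 2 = Real.exp 1 := by rw [← Real.exp_nat_mul]; norm_num
      nlinarith [Real.exp_one_lt_d9, Real.exp_pos (1 / 2)]
    refine (norm_sub_le _ _).trans ?_
    rw [norm_mul]
    have h5 : ‖((x + y * I) / I : ℂ) ^ (1 / 2 : ℂ)‖ *
        ‖cexp (-(Real.pi * I * (-1 / (x + y * I)) / 12))‖ ≤ 1 * 2 := by gcongr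
    linarith

/-- `m sinh m - cosh m + 1 - m² / 2`. -/
noncomputable def coshKernel (m : ℝ) : ℝ := m * Real.sinh m - Real.cosh m + 1 - m ^ 2 / 2

theorem abs_sub_le_of_hasDerivAt_of_le {f f' : ℝ → ℝ} {m C : ℝ} (hm : 0 ≤ m)
    (hf : ∀ x, HasDerivAt f (f' x) x) (hC : ∀ x, 0 ≤ x → x ≤ m → |f' x| ≤ C) :
    |f m - f 0| ≤ C * m := by
  have := (convex_Icc (0 : ℝ) m).norm_image_sub_le_of_norm_hasDerivWithin_le (f := f) (f' := f')
    (C := C) (fun x _ ↦ (hf x).hasDerivWithinAt) (fun x hx ↦ hC x hx.1 hx.2)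
    (Set.left_mem_Icc.2 hm) (Set.right_mem_Icc.2 hm)
  simpa [abs_of_nonneg hm] using this

theorem cosh_mono {x m : ℝ} (hx : 0 ≤ x) (h : x ≤ m) : Real.cosh x ≤ Real.cosh m := by
  rw [Real.cosh_le_cosh, abs_of_nonneg hx, abs_of_nonneg (hx.trans h)]
  exact h

theorem abs_sinh_le {m : ℝ} (hm : 0 ≤ m) : |Real.sinh m| ≤ m * Real.cosh m := by
  have := abs_sub_le_of_hasDerivAt_of_le (C := Real.cosh m) hm Real.hasDerivAt_sinh
    (fun x h0 h1 ↦ by rw [abs_of_pos (Real.cosh_pos x)]; exact cosh_mono h0 h1)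
  rw [Real.sinh_zero, sub_zero] at this
  linarith

theorem abs_cosh_sub_one_le {m : ℝ} (hm : 0 ≤ m) : |Real.cosh m - 1| ≤ m ^ 2 * Real.cosh m := by
  have := abs_sub_le_of_hasDerivAt_of_le (C := m * Real.cosh m) hm Real.hasDerivAt_cosh
    (fun x h0 h1 ↦ (abs_sinh_le h0).trans
      (mul_le_mul h1 (cosh_mono h0 h1) (Real.cosh_pos x).le hm))
  rw [Real.cosh_zero] at this
  linarith

theorem hasDerivAt_coshKernel (m : ℝ) :
    HasDerivAt coshKernel (m * (Real.cosh m - 1)) m := by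
  unfold coshKernel
  have := ((((hasDerivAt_id m).mul (Real.hasDerivAt_sinh m)).sub (Real.hasDerivAt_cosh m)).add_const
    1).sub (((hasDerivAt_id m).pow 2).div_const 2)
  convert! this using 1
  simp
  ring

theorem abs_coshKernel_le {m : ℝ} (hm : 0 ≤ m) : |coshKernel m| ≤ m ^ 4 * Real.cosh m := by
  have := abs_sub_le_of_hasDerivAt_of_le (C := m ^ 3 * Real.cosh m) hm hasDerivAt_coshKernel
    (fun x h0 h1 ↦ by
      rw [abs_mul, abs_of_nonneg h0]
      have h2 : x ^ 2 * Real.cosh x ≤ m ^ 2 * Real.cosh m :=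
        mul_le_mul (by gcongr) (cosh_mono h0 h1) (Real.cosh_pos x).le (by positivity)
      have := mul_le_mul h1 ((abs_cosh_sub_one_le h0).trans h2) (abs_nonneg _) hm
      linarith)
  have h0 : coshKernel 0 = 0 := by simp [coshKernel]
  rw [h0, sub_zero] at this
  linarith

theorem cosh_le_exp {m : ℝ} (hm : 0 ≤ m) : Real.cosh m ≤ Real.exp m := by
  rw [Real.cosh_eq]
  linarith [Real.exp_le_exp.2 (show -m ≤ m by linarith)]

theorem sq_le_two_mul_exp {m : ℝ} (hm : 0 ≤ m) : m ^ 2 ≤ 2 * Real.exp m := by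
  linarith [Real.quadratic_le_exp_of_nonneg hm]

section

open Complex MeasureTheory Set Filter Topology

theorem integral_eq_two_mul_integral_Ioi {f : ℝ → ℂ} (hf : Integrable f)
    (h : ∀ u, f (-u) = f u) : ∫ u, f u = 2 * ∫ u in Ioi 0, f u := by
  have h1 : ∫ u in Iic 0, f u = ∫ u in Ioi 0, f u := by
    rw [← neg_zero, ← integral_comp_neg_Ioi, neg_zero]
    simp_rw [h]
  rw [← integral_add_compl (measurableSet_Ioi (a := (0 : ℝ))) hf, compl_Ioi, h1, two_mul]

theorem integrable_exp_neg_mul_sq_add {σ : ℝ} (hσ : 0 < σ) (c : ℝ) :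
    Integrable fun u : ℝ ↦ Real.exp (-σ * u ^ 2) * Real.exp (c * u) := by
  have := (integrable_cexp_quadratic (b := σ) (by simpa using hσ) c 0).norm
  refine this.congr (Eventually.of_forall fun u ↦ ?_)
  simp only [add_zero, Complex.exp_add, norm_mul]
  rw [norm_cexp_neg_mul_sq, norm_exp]
  simp

theorem integrableOn_Ioi_of_norm_le {f : ℝ → ℂ} {σ c C : ℝ} (hσ : 0 < σ)
    (hf : ContinuousOn f (Ioi 0))
    (h : ∀ u, 0 < u → ‖f u‖ ≤ C * (Real.exp (-σ * u ^ 2) * Real.exp (c * u))) :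
    IntegrableOn f (Ioi 0) :=
  ((integrable_exp_neg_mul_sq_add hσ c).const_mul C).integrableOn.mono'
    (hf.aestronglyMeasurable measurableSet_Ioi)
    ((ae_restrict_iff' measurableSet_Ioi).2 (Eventually.of_forall fun u hu ↦ h u hu))

theorem integral_Ioi_gaussian_mul_cosh {s : ℂ} (hs : 0 < s.re) (a : ℝ) :
    ∫ u in Ioi (0 : ℝ), cexp (-s * u ^ 2) * (Real.cosh (2 * a * u) : ℝ) =
      (Real.pi / s) ^ (1 / 2 : ℂ) / 2 * cexp (a ^ 2 / s) := by
  have hs0 : s ≠ 0 := fun h ↦ by simp [h] at hs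
  have h1 := integral_cexp_quadratic (b := -s) (by simpa using hs) (2 * a) 0
  have h2 := integral_cexp_quadratic (b := -s) (by simpa using hs) (-(2 * a)) 0
  have h4 (u : ℝ) : cexp (-s * u ^ 2) * (Real.cosh (2 * a * u) : ℝ) =
      (cexp (-s * u ^ 2 + 2 * a * u + 0) + cexp (-s * u ^ 2 + -(2 * a) * u + 0)) / 2 := by
    rw [Complex.ofReal_cosh, Complex.cosh]
    simp only [add_zero, Complex.exp_add]
    push_cast
    ring_nf
  have h3 : ∫ u : ℝ, cexp (-s * u ^ 2) * (Real.cosh (2 * a * u) : ℝ) =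
      (Real.pi / s) ^ (1 / 2 : ℂ) * cexp (a ^ 2 / s) := by
    simp_rw [h4]
    rw [integral_div, integral_add (integrable_cexp_quadratic hs _ _)
      (integrable_cexp_quadratic hs _ _), h1, h2, neg_neg]
    have e1 : (0 : ℂ) - (2 * a) ^ 2 / (4 * -s) = a ^ 2 / s := by field_simp; ring
    have e2 : (0 : ℂ) - (-(2 * a)) ^ 2 / (4 * -s) = a ^ 2 / s := by field_simp; ring
    rw [e1, e2]
    ring
  have h5 := integral_eq_two_mul_integral_Ioi
    (f := fun u : ℝ ↦ cexp (-s * u ^ 2) * (Real.cosh (2 * a * u) : ℝ)) (by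
      simp_rw [h4]
      exact ((integrable_cexp_quadratic hs _ _).add (integrable_cexp_quadratic hs _ _)).div_const 2)
    (fun u ↦ by simp)
  rw [h3] at h5
  linear_combination -h5 / 2

theorem integral_Ioi_eq_zero_of_hasDerivAt_of_norm_le {F F' : ℝ → ℂ} {σ c C C' : ℝ} (hσ : 0 < σ)
    (hF : ∀ u, 0 < u → HasDerivAt F (F' u) u) (h0 : F 0 = 0) (hF' : ContinuousOn F' (Ioi 0))
    (hC : ∀ u, 0 < u → ‖F u‖ ≤ C * u * (Real.exp (-σ * u ^ 2) * Real.exp (c * u)))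
    (hC' : ∀ u, 0 < u → ‖F' u‖ ≤ C' * (Real.exp (-σ * u ^ 2) * Real.exp (c * u))) :
    ∫ u in Ioi 0, F' u = 0 := by
  have hC0 : 0 ≤ C := by
    have := (norm_nonneg _).trans (hC 1 one_pos)
    rw [mul_one] at this
    exact nonneg_of_mul_nonneg_left this (by positivity)
  have hcont : ContinuousOn F (Ioi 0) := fun u hu ↦ (hF u hu).continuousAt.continuousWithinAt
  have hInt' := integrableOn_Ioi_of_norm_le hσ hF' hC'
  have hInt : IntegrableOn F (Ioi 0) := integrableOn_Ioi_of_norm_le (c := c + 1) (C := C) hσ hcont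
    fun u hu ↦ (hC u hu).trans (by
      rw [show (c + 1) * u = c * u + u by ring, Real.exp_add]
      have h1 : u ≤ Real.exp u := by linarith [Real.add_one_le_exp u]
      have h2 : 0 ≤ C * (Real.exp (-σ * u ^ 2) * Real.exp (c * u)) := by positivity
      nlinarith)
  have hlim := tendsto_zero_of_hasDerivAt_of_integrableOn_Ioi hF hInt' hInt
  have hcont0 : ContinuousWithinAt F (Ici 0) 0 := by
    rw [ContinuousWithinAt, h0]
    have hb : Continuous fun u : ℝ ↦ C * u * (Real.exp (-σ * u ^ 2) * Real.exp (c * u)) := by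
      fun_prop
    have hb0 := hb.tendsto 0
    rw [mul_zero, zero_mul] at hb0
    refine squeeze_zero_norm' ?_ (hb0.mono_left nhdsWithin_le_nhds)
    filter_upwards [self_mem_nhdsWithin] with u hu
    rcases eq_or_lt_of_le (mem_Ici.1 hu) with rfl | hu'
    · simp [h0]
    · exact hC u hu'
  rw [integral_Ioi_of_hasDerivAt_of_tendsto hcont0 hF hInt' hlim, h0, sub_zero]

theorem hasDerivAt_cexp_neg_mul_sq (s : ℂ) (u : ℝ) :
    HasDerivAt (fun u : ℝ ↦ cexp (-s * u ^ 2)) (-(2 * s * u) * cexp (-s * u ^ 2)) u := by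
  have h1 : HasDerivAt (fun z : ℂ ↦ cexp (-s * z ^ 2))
      (-(2 * s * u) * cexp (-s * u ^ 2)) (u : ℂ) := by
    have := (((hasDerivAt_id (u : ℂ)).pow 2).const_mul (-s)).cexp
    convert! this using 1
    simp
    ring
  exact h1.comp_ofReal

theorem integrableOn_gaussian_Ioi {s : ℂ} (hs : 0 < s.re) :
    IntegrableOn (fun u : ℝ ↦ cexp (-s * u ^ 2)) (Ioi 0) := by
  refine integrableOn_Ioi_of_norm_le (c := 0) (C := 1) hs
    (Continuous.continuousOn (by fun_prop)) fun u _ ↦ ?_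
  rw [norm_cexp_neg_mul_sq]
  simp

theorem integrableOn_sq_mul_gaussian_Ioi {s : ℂ} (hs : 0 < s.re) :
    IntegrableOn (fun u : ℝ ↦ (u : ℂ) ^ 2 * cexp (-s * u ^ 2)) (Ioi 0) := by
  refine integrableOn_Ioi_of_norm_le (c := 1) (C := 2) hs
    (Continuous.continuousOn (by fun_prop)) fun u hu ↦ ?_
  rw [norm_mul, norm_cexp_neg_mul_sq, norm_pow, norm_real, Real.norm_eq_abs, sq_abs, one_mul]
  have := sq_le_two_mul_exp hu.le
  have := Real.exp_pos (-s.re * u ^ 2)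
  nlinarith

theorem integrableOn_gaussian_mul_cosh_Ioi {s : ℂ} (hs : 0 < s.re) {a : ℝ} (ha : 0 ≤ a) :
    IntegrableOn (fun u : ℝ ↦ cexp (-s * u ^ 2) * (Real.cosh (2 * a * u) : ℝ)) (Ioi 0) := by
  refine integrableOn_Ioi_of_norm_le (c := 2 * a) (C := 1) hs
    (Continuous.continuousOn (by fun_prop)) fun u hu ↦ ?_
  rw [norm_mul, norm_cexp_neg_mul_sq, norm_real, Real.norm_eq_abs, abs_of_pos (Real.cosh_pos _),
    one_mul]
  gcongr
  exact cosh_le_exp (by positivity)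

theorem integral_Ioi_sq_mul_gaussian {s : ℂ} (hs : 0 < s.re) :
    ∫ u in Ioi (0 : ℝ), (u : ℂ) ^ 2 * cexp (-s * u ^ 2) =
      (Real.pi / s) ^ (1 / 2 : ℂ) / (4 * s) := by
  have hs0 : s ≠ 0 := fun h ↦ by simp [h] at hs
  have h := integral_Ioi_eq_zero_of_hasDerivAt_of_norm_le
    (F := fun u : ℝ ↦ (u : ℂ) * cexp (-s * u ^ 2))
    (F' := fun u : ℝ ↦ cexp (-s * u ^ 2) - 2 * s * ((u : ℂ) ^ 2 * cexp (-s * u ^ 2)))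
    (c := 1) (C := 1) (C' := 1 + 2 * ‖s‖ * 2) hs
    (fun u _ ↦ by
      have := (hasDerivAt_id u).ofReal_comp.mul (hasDerivAt_cexp_neg_mul_sq s u)
      convert! this using 1
      simp
      ring)
    (by simp) (Continuous.continuousOn (by fun_prop))
    (fun u hu ↦ by
      rw [norm_mul, norm_cexp_neg_mul_sq, norm_real, Real.norm_eq_abs, abs_of_pos hu]
      have : 1 ≤ Real.exp (1 * u) := Real.one_le_exp (by linarith)
      have : 0 ≤ u * Real.exp (-s.re * u ^ 2) := by positivity
      nlinarith)
    (fun u hu ↦ by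
      refine (norm_sub_le _ _).trans ?_
      rw [norm_mul, norm_mul, norm_mul, norm_pow, norm_cexp_neg_mul_sq, norm_real,
        Real.norm_eq_abs, sq_abs, one_mul, norm_ofNat]
      have h1 := sq_le_two_mul_exp hu.le
      have h2 : 1 ≤ Real.exp u := Real.one_le_exp hu.le
      have h3 := Real.exp_pos (-s.re * u ^ 2)
      have h4 := norm_nonneg s
      have h5 := mul_le_mul_of_nonneg_left h1
        (by positivity : 0 ≤ 2 * ‖s‖ * Real.exp (-s.re * u ^ 2))
      nlinarith)
  have h2 : ∫ u in Ioi (0 : ℝ), (cexp (-s * u ^ 2) - 2 * s * ((u : ℂ) ^ 2 * cexp (-s * u ^ 2))) =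
      (Real.pi / s) ^ (1 / 2 : ℂ) / 2 -
        2 * s * ∫ u in Ioi (0 : ℝ), (u : ℂ) ^ 2 * cexp (-s * u ^ 2) := by
    rw [integral_sub (integrableOn_gaussian_Ioi hs)
      ((integrableOn_sq_mul_gaussian_Ioi hs).const_mul _), integral_const_mul,
      integral_gaussian_complex_Ioi hs]
  rw [h2] at h
  rw [eq_div_iff (mul_ne_zero (by norm_num : (4 : ℂ) ≠ 0) hs0)]
  linear_combination -2 * h

theorem norm_coshKernel_gaussian_le (s : ℂ) {a u : ℝ} (ha : 0 ≤ a) (hu : 0 < u) :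
    ‖cexp (-s * u ^ 2) * (coshKernel (2 * a * u) / u ^ 2 : ℝ)‖ ≤
      (2 * (2 * a) ^ 4) * (Real.exp (-s.re * u ^ 2) * Real.exp ((2 * a + 1) * u)) := by
  rw [norm_mul, norm_cexp_neg_mul_sq, norm_real, Real.norm_eq_abs, abs_div,
    abs_of_pos (by positivity : 0 < u ^ 2), show (2 * a + 1) * u = 2 * a * u + u by ring,
    Real.exp_add, mul_left_comm]
  gcongr
  rw [div_le_iff₀ (by positivity)]
  refine (abs_coshKernel_le (by positivity)).trans ?_
  have h1 := cosh_le_exp (m := 2 * a * u) (by positivity)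
  have h2 := sq_le_two_mul_exp hu.le
  calc (2 * a * u) ^ 4 * Real.cosh (2 * a * u) ≤ (2 * a * u) ^ 4 * Real.exp (2 * a * u) := by gcongr
    _ = (2 * a) ^ 4 * Real.exp (2 * a * u) * u ^ 2 * u ^ 2 := by ring
    _ ≤ (2 * a) ^ 4 * Real.exp (2 * a * u) * (2 * Real.exp u) * u ^ 2 := by gcongr
    _ = _ := by ring

theorem continuous_coshKernel : Continuous coshKernel := by
  unfold coshKernel
  fun_prop

theorem continuousOn_coshKernel_gaussian (s : ℂ) (a : ℝ) :
    ContinuousOn (fun u : ℝ ↦ cexp (-s * u ^ 2) * (coshKernel (2 * a * u) / u ^ 2 : ℝ))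
      (Ioi 0) := by
  refine ContinuousOn.mul (Continuous.continuousOn (by fun_prop)) ?_
  refine continuous_ofReal.comp_continuousOn (ContinuousOn.div ?_ (by fun_prop)
    fun u hu ↦ pow_ne_zero _ (ne_of_gt hu))
  exact (continuous_coshKernel.comp (by fun_prop)).continuousOn

theorem integrableOn_coshKernel_gaussian {s : ℂ} (hs : 0 < s.re) {a : ℝ} (ha : 0 ≤ a) :
    IntegrableOn (fun u : ℝ ↦ cexp (-s * u ^ 2) * (coshKernel (2 * a * u) / u ^ 2 : ℝ)) (Ioi 0) :=
  integrableOn_Ioi_of_norm_le hs (continuousOn_coshKernel_gaussian s a)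
    fun _ hu ↦ norm_coshKernel_gaussian_le s ha hu

theorem integral_Ioi_coshKernel_gaussian {s : ℂ} (hs : 0 < s.re) {a : ℝ} (ha : 0 ≤ a) :
    ∫ u in Ioi (0 : ℝ), cexp (-s * u ^ 2) * (coshKernel (2 * a * u) / u ^ 2 : ℝ) =
      s * (Real.pi / s) ^ (1 / 2 : ℂ) * (cexp (a ^ 2 / s) - 1 - a ^ 2 / s) := by
  have hs0 : s ≠ 0 := fun h ↦ by simp [h] at hs
  have hV (u : ℝ) (hu : 0 < u) :
      |Real.cosh (2 * a * u) - 1 - (2 * a * u) ^ 2 / 2| ≤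
        2 * (2 * a * u) ^ 2 * Real.exp (2 * a * u) := by
    have h1 := cosh_le_exp (m := 2 * a * u) (by positivity)
    have h2 := abs_cosh_sub_one_le (m := 2 * a * u) (by positivity)
    have h3 := abs_sub (Real.cosh (2 * a * u) - 1) ((2 * a * u) ^ 2 / 2)
    rw [abs_of_nonneg (by positivity : 0 ≤ (2 * a * u) ^ 2 / 2)] at h3
    have h4 : 1 ≤ Real.exp (2 * a * u) := Real.one_le_exp (by positivity)
    have h5 := mul_le_mul_of_nonneg_left h1 (sq_nonneg (2 * a * u))
    nlinarith [sq_nonneg (2 * a * u)]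
  have h := integral_Ioi_eq_zero_of_hasDerivAt_of_norm_le
    (F := fun u : ℝ ↦ cexp (-s * u ^ 2) *
      ((Real.cosh (2 * a * u) - 1 - (2 * a * u) ^ 2 / 2) / u : ℝ))
    (F' := fun u : ℝ ↦ cexp (-s * u ^ 2) * (coshKernel (2 * a * u) / u ^ 2 : ℝ) -
      2 * s * (cexp (-s * u ^ 2) * (Real.cosh (2 * a * u) : ℝ) - cexp (-s * u ^ 2) -
        2 * a ^ 2 * ((u : ℂ) ^ 2 * cexp (-s * u ^ 2))))
    (c := 2 * a + 1) (C := 8 * a ^ 2)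
    (C' := 2 * (2 * a) ^ 4 + 2 * ‖s‖ * (4 * (2 * a) ^ 2)) hs
    (fun u hu ↦ by
      have h1 : HasDerivAt (fun u : ℝ ↦ (Real.cosh (2 * a * u) - 1 - (2 * a * u) ^ 2 / 2) / u)
          (coshKernel (2 * a * u) / u ^ 2) u := by
        have h2 := (hasDerivAt_id u).const_mul (2 * a)
        have h3 := (((h2.cosh).sub_const 1).sub ((h2.pow 2).div_const 2)).div
          (hasDerivAt_id u) hu.ne'
        convert! h3 using 1
        simp [coshKernel]
        ring
      have := (hasDerivAt_cexp_neg_mul_sq s u).mul h1.ofReal_comp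
      convert! this using 1
      have hu0 : (u : ℂ) ≠ 0 := by exact_mod_cast hu.ne'
      push_cast
      field_simp
      ring)
    (by simp)
    (by
      refine (continuousOn_coshKernel_gaussian s a).sub (Continuous.continuousOn ?_)
      fun_prop)
    (fun u hu ↦ by
      rw [norm_mul, norm_cexp_neg_mul_sq, norm_real, Real.norm_eq_abs, abs_div, abs_of_pos hu,
        mul_left_comm]
      gcongr
      rw [div_le_iff₀ hu]
      refine (hV u hu).trans ?_
      have : Real.exp (2 * a * u) ≤ Real.exp ((2 * a + 1) * u) := Real.exp_le_exp.2 (by linarith)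
      nlinarith [mul_nonneg (sq_nonneg (a * u)) (sub_nonneg.2 this)])
    (fun u hu ↦ by
      refine (norm_sub_le _ _).trans ?_
      have h1 := norm_coshKernel_gaussian_le s ha hu
      have h2 : cexp (-s * u ^ 2) * (Real.cosh (2 * a * u) : ℝ) - cexp (-s * u ^ 2) -
        2 * a ^ 2 * ((u : ℂ) ^ 2 * cexp (-s * u ^ 2)) = cexp (-s * u ^ 2) *
          ((Real.cosh (2 * a * u) - 1 - (2 * a * u) ^ 2 / 2 : ℝ) : ℂ) := by
        push_cast; ring
      rw [add_mul]
      refine add_le_add h1 ?_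
      rw [h2, norm_mul, norm_mul, norm_mul, norm_ofNat, norm_cexp_neg_mul_sq s, norm_real,
        Real.norm_eq_abs]
      have h3 : |Real.cosh (2 * a * u) - 1 - (2 * a * u) ^ 2 / 2| ≤
          4 * (2 * a) ^ 2 * Real.exp ((2 * a + 1) * u) := by
        refine (hV u hu).trans ?_
        rw [show (2 * a + 1) * u = 2 * a * u + u by ring, Real.exp_add]
        have := sq_le_two_mul_exp hu.le
        calc _ = 2 * (2 * a) ^ 2 * Real.exp (2 * a * u) * u ^ 2 := by ring
          _ ≤ 2 * (2 * a) ^ 2 * Real.exp (2 * a * u) * (2 * Real.exp u) := by gcongr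
          _ = _ := by ring
      calc _ ≤ 2 * ‖s‖ * (Real.exp (-s.re * u ^ 2) *
            (4 * (2 * a) ^ 2 * Real.exp ((2 * a + 1) * u))) := by gcongr
        _ = _ := by ring)
  have i1 := integrableOn_gaussian_Ioi hs
  have i2 := integrableOn_sq_mul_gaussian_Ioi hs
  have i3 := integrableOn_gaussian_mul_cosh_Ioi hs ha
  have i4 := i2.const_mul (2 * (a : ℂ) ^ 2)
  have i5 : IntegrableOn (fun u : ℝ ↦ cexp (-s * u ^ 2) * (Real.cosh (2 * a * u) : ℝ) -
      cexp (-s * u ^ 2)) (Ioi 0) := i3.sub i1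
  have i6 : IntegrableOn (fun u : ℝ ↦ cexp (-s * u ^ 2) * (Real.cosh (2 * a * u) : ℝ) -
      cexp (-s * u ^ 2) - 2 * a ^ 2 * ((u : ℂ) ^ 2 * cexp (-s * u ^ 2))) (Ioi 0) := i5.sub i4
  rw [integral_sub (integrableOn_coshKernel_gaussian hs ha) (i6.const_mul _), integral_const_mul,
    integral_sub i5 i4, integral_const_mul, integral_sub i3 i1,
    integral_Ioi_sq_mul_gaussian hs, integral_gaussian_complex_Ioi hs,
    integral_Ioi_gaussian_mul_cosh hs a] at h
  rw [← sub_eq_zero, ← h]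
  field_simp
  ring

/-- The inverse Laplace transform of `s ↦ √s (exp (a² / s) - 1 - a² / s)`. -/
noncomputable def besselKernel (a τ : ℝ) : ℝ :=
  coshKernel (2 * a * √τ) / (2 * √Real.pi * (τ * √τ))

theorem besselKernel_sq_mul {a u : ℝ} (hu : 0 < u) :
    2 * u * besselKernel a (u ^ 2) = coshKernel (2 * a * u) / u ^ 2 / √Real.pi := by
  have : 0 < √Real.pi := Real.sqrt_pos.2 Real.pi_pos
  rw [besselKernel, Real.sqrt_sq hu.le]
  field_simp

theorem mul_pi_div_cpow_half {s : ℂ} (hs : 0 < s.re) :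
    s * (Real.pi / s) ^ (1 / 2 : ℂ) = (√Real.pi : ℝ) * s ^ (1 / 2 : ℂ) := by
  have hs0 : s ≠ 0 := fun h ↦ by simp [h] at hs
  have harg : s.arg ≠ Real.pi := by
    rw [Ne, arg_eq_pi_iff, not_and_or, not_lt]
    exact Or.inl hs.le
  have h1 : ((Real.pi : ℂ) / s) ^ (1 / 2 : ℂ) = (√Real.pi : ℝ) * (s ^ (1 / 2 : ℂ))⁻¹ := by
    rw [← inv_cpow _ _ harg, div_eq_mul_inv, Real.sqrt_eq_rpow, ofReal_cpow Real.pi_pos.le,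
      cpow_def_of_ne_zero (mul_ne_zero (by simp [Real.pi_ne_zero]) (inv_ne_zero hs0)),
      cpow_def_of_ne_zero (by simp [Real.pi_ne_zero]), cpow_def_of_ne_zero (inv_ne_zero hs0),
      log_ofReal_mul Real.pi_pos (inv_ne_zero hs0), ← Complex.exp_add, ofReal_log Real.pi_pos.le]
    push_cast
    ring_nf
  have h2 : s ^ (1 / 2 : ℂ) * s ^ (1 / 2 : ℂ) = s := by
    rw [← cpow_add _ _ hs0]; norm_num
  have h3 : s ^ (1 / 2 : ℂ) ≠ 0 := by simp [cpow_eq_zero_iff, hs0]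
  rw [h1]
  nth_rewrite 1 [← h2]
  field_simp

theorem two_rpow_smul_besselKernel (s : ℂ) (a : ℝ) {u : ℝ} (hu : 0 < u) :
    (2 * u ^ ((2 : ℝ) - 1)) • (cexp (-s * ((u ^ (2 : ℝ) : ℝ) : ℂ)) *
      (besselKernel a (u ^ (2 : ℝ)) : ℂ)) =
      cexp (-s * u ^ 2) * (coshKernel (2 * a * u) / u ^ 2 : ℝ) * ((√Real.pi)⁻¹ : ℝ) := by
  have h := besselKernel_sq_mul (a := a) hu
  rw [show (2 : ℝ) - 1 = 1 by norm_num, Real.rpow_one, Real.rpow_two, real_smul, ofReal_pow,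
    mul_left_comm, ← ofReal_mul, h, mul_assoc (cexp _), ← ofReal_mul, div_eq_mul_inv (_ / _)]

theorem integrableOn_besselKernel {s : ℂ} (hs : 0 < s.re) {a : ℝ} (ha : 0 ≤ a) :
    IntegrableOn (fun τ : ℝ ↦ cexp (-s * τ) * (besselKernel a τ : ℂ)) (Ioi 0) := by
  rw [← integrableOn_Ioi_comp_rpow_iff _ two_ne_zero, abs_two]
  refine IntegrableOn.congr_fun
    ((integrableOn_coshKernel_gaussian hs ha).mul_const ((√Real.pi)⁻¹ : ℝ)) ?_ measurableSet_Ioi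
  intro u hu
  exact (two_rpow_smul_besselKernel s a hu).symm

theorem integral_Ioi_besselKernel {s : ℂ} (hs : 0 < s.re) {a : ℝ} (ha : 0 ≤ a) :
    ∫ τ in Ioi (0 : ℝ), cexp (-s * τ) * (besselKernel a τ : ℂ) =
      s ^ (1 / 2 : ℂ) * (cexp (a ^ 2 / s) - 1 - a ^ 2 / s) := by
  rw [← integral_comp_rpow_Ioi_of_pos (p := 2) two_pos,
    setIntegral_congr_fun measurableSet_Ioi fun u hu ↦ two_rpow_smul_besselKernel s a hu,
    integral_mul_const, integral_Ioi_coshKernel_gaussian hs ha, mul_pi_div_cpow_half hs]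
  have : ((√Real.pi : ℝ) : ℂ) ≠ 0 := by
    exact_mod_cast (Real.sqrt_pos.2 Real.pi_pos).ne'
  push_cast
  field_simp

open FourierTransform in
theorem fourier_besselKernel {a y : ℝ} (ha : 0 ≤ a) (hy : 0 < y) :
    𝓕 ((Ioi (0 : ℝ)).indicator fun τ ↦ cexp (-y * τ) * (besselKernel a τ : ℂ)) =
      fun ξ : ℝ ↦ (y + 2 * Real.pi * ξ * I : ℂ) ^ (1 / 2 : ℂ) *
        (cexp (a ^ 2 / (y + 2 * Real.pi * ξ * I)) - 1 - a ^ 2 / (y + 2 * Real.pi * ξ * I)) := by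
  ext ξ
  rw [Real.fourier_real_eq_integral_exp_smul, ← integral_Ioi_besselKernel (by simpa using hy) ha,
    ← integral_indicator measurableSet_Ioi]
  congr 1
  ext τ
  by_cases hτ : τ ∈ Ioi (0 : ℝ)
  · rw [indicator_of_mem hτ, indicator_of_mem hτ, smul_eq_mul, ← mul_assoc, ← Complex.exp_add]
    congr 2
    push_cast
    ring
  · rw [indicator_of_notMem hτ, indicator_of_notMem hτ, smul_zero]

theorem continuousAt_besselKernel (a : ℝ) {t : ℝ} (ht : 0 < t) :
    ContinuousAt (besselKernel a) t := by
  unfold besselKernel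
  have h1 : 0 < √t := Real.sqrt_pos.2 ht
  have h2 : 0 < √Real.pi := Real.sqrt_pos.2 Real.pi_pos
  refine ContinuousAt.div ?_ (by fun_prop) (by positivity)
  exact (continuous_coshKernel.comp (by fun_prop)).continuousAt

theorem norm_cexp_sub_one_sub_le (w : ℂ) : ‖cexp w - 1 - w‖ ≤ ‖w‖ ^ 2 * Real.exp ‖w‖ := by
  have := norm_exp_sub_sum_le_norm_mul_exp w 2
  simpa [Finset.sum_range_succ, sub_sub] using this

theorem norm_cpow_half (s : ℂ) : ‖s ^ (1 / 2 : ℂ)‖ = √‖s‖ := by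
  rw [show (1 / 2 : ℂ) = ((1 / 2 : ℝ) : ℂ) by push_cast; rfl, norm_cpow_real, Real.sqrt_eq_rpow]

/-- The Laplace transform of `besselKernel a`. -/
noncomputable def besselTransform (a : ℝ) (s : ℂ) : ℂ :=
  s ^ (1 / 2 : ℂ) * (cexp (a ^ 2 / s) - 1 - a ^ 2 / s)

theorem norm_besselTransform_le (a : ℝ) {s : ℂ} (hs : 0 < s.re) :
    ‖besselTransform a s‖ ≤ √‖s‖ * ((a ^ 2 / ‖s‖) ^ 2 * Real.exp (a ^ 2 / s.re)) := by
  rw [besselTransform, norm_mul, norm_cpow_half]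
  have h : ‖(a ^ 2 / s : ℂ)‖ = a ^ 2 / ‖s‖ := by
    rw [norm_div, norm_pow, norm_real, Real.norm_eq_abs, sq_abs]
  have h1 : s.re ≤ ‖s‖ := Complex.re_le_norm s
  gcongr
  refine (norm_cexp_sub_one_sub_le _).trans ?_
  rw [h]
  gcongr

theorem re_sub_mul_I (y x : ℝ) : (y - x * I : ℂ).re = y := by simp

theorem continuous_besselTransform (a : ℝ) {y : ℝ} (hy : 0 < y) :
    Continuous fun x : ℝ ↦ besselTransform a (y - x * I) := by
  have h0 : ∀ x : ℝ, (y - x * I : ℂ) ≠ 0 := fun x h ↦ by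
    have := re_sub_mul_I y x
    rw [h] at this
    simp at this
    exact hy.ne this
  unfold besselTransform
  refine Continuous.mul ?_ ?_
  · refine Continuous.cpow (by fun_prop) continuous_const fun x ↦ Or.inl ?_
    rwa [re_sub_mul_I]
  · have : Continuous fun x : ℝ ↦ (a ^ 2 / (y - x * I) : ℂ) :=
      Continuous.div continuous_const (by fun_prop) h0
    fun_prop

theorem sq_norm_sub_mul_I (y x : ℝ) : ‖(y - x * I : ℂ)‖ ^ 2 = y ^ 2 + x ^ 2 := by
  rw [Complex.sq_norm, normSq_apply]
  simp
  ring

theorem integrable_besselTransform (a : ℝ) {y : ℝ} (hy : 0 < y) (hy1 : y ≤ 1) :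
    Integrable fun x : ℝ ↦ besselTransform a (y - x * I) := by
  have h := (integrable_rpow_neg_one_add_norm_sq (E := ℝ) (μ := volume) (r := 3 / 2)
    (by simp; norm_num)).const_mul (a ^ 4 * Real.exp (a ^ 2 / y) * (√y * y)⁻¹)
  refine h.mono' (continuous_besselTransform a hy).aestronglyMeasurable (ae_of_all _ fun x ↦ ?_)
  have hs : 0 < (y - x * I : ℂ).re := by rwa [re_sub_mul_I]
  refine (norm_besselTransform_le a hs).trans ?_
  rw [re_sub_mul_I]
  set r := ‖(y - x * I : ℂ)‖ with hr
  have hr0 : 0 < r := hs.trans_le (Complex.re_le_norm _)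
  have h1 : y ^ 2 * (1 + ‖x‖ ^ 2) ≤ r ^ 2 := by
    rw [hr, sq_norm_sub_mul_I, Real.norm_eq_abs, sq_abs]
    nlinarith [mul_nonneg (sq_nonneg x) (by nlinarith : (0 : ℝ) ≤ 1 - y ^ 2)]
  set q := √(1 + ‖x‖ ^ 2) with hq
  have hq0 : 0 < q := Real.sqrt_pos.2 (by positivity)
  have h2 : y * q ≤ r := by
    refine le_of_sq_le_sq ?_ hr0.le
    rw [mul_pow, hq, Real.sq_sqrt (by positivity)]
    exact h1
  have h3 : (1 + ‖x‖ ^ 2) ^ (-(3 / 2) / 2 : ℝ) = (√q * q)⁻¹ := by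
    have : 1 + ‖x‖ ^ 2 = q ^ (2 : ℝ) := by rw [Real.rpow_two, hq, Real.sq_sqrt (by positivity)]
    rw [this, ← Real.rpow_mul hq0.le, Real.sqrt_eq_rpow, ← Real.rpow_add_one hq0.ne',
      ← Real.rpow_neg hq0.le]
    norm_num
  have h4 : √r * (a ^ 2 / r) ^ 2 = a ^ 4 * (√r * r)⁻¹ := by
    have := Real.sq_sqrt hr0.le
    have h5 : √r ≠ 0 := (Real.sqrt_pos.2 hr0).ne'
    field_simp
    rw [this]
    ring
  rw [h3, ← mul_assoc, h4]
  have h5 : (√r * r)⁻¹ ≤ (√y * y)⁻¹ * (√q * q)⁻¹ := by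
    rw [← mul_inv]
    have : √y * y * (√q * q) = √(y * q) * (y * q) := by
      rw [Real.sqrt_mul hy.le]; ring
    rw [this]
    gcongr
  calc a ^ 4 * (√r * r)⁻¹ * Real.exp (a ^ 2 / y)
      ≤ a ^ 4 * ((√y * y)⁻¹ * (√q * q)⁻¹) * Real.exp (a ^ 2 / y) := by gcongr
    _ = _ := by ring

open FourierTransform in
theorem integral_besselTransform {a y t : ℝ} (ha : 0 ≤ a) (hy : 0 < y) (hy1 : y ≤ 1)
    (ht : 0 < t) :
    ∫ x : ℝ, besselTransform a (y - x * I) * cexp ((y - x * I) * t) =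
      2 * Real.pi * besselKernel a t := by
  have hcomp : (fun ξ : ℝ ↦ besselTransform a (y + 2 * Real.pi * ξ * I)) =
      fun ξ : ℝ ↦ besselTransform a (y - ((-(2 * Real.pi) * ξ : ℝ) : ℂ) * I) := by
    ext ξ
    push_cast
    ring_nf
  have hpi : -(2 * Real.pi) ≠ 0 := by simp [Real.pi_ne_zero]
  have hInt : Integrable fun ξ : ℝ ↦ besselTransform a (y + 2 * Real.pi * ξ * I) := by
    rw [hcomp]
    exact (integrable_besselTransform a hy hy1).comp_mul_left' hpi
  have hF := fourier_besselKernel ha hy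
  have hker : Integrable ((Ioi (0 : ℝ)).indicator
      fun τ : ℝ ↦ cexp (-y * τ) * (besselKernel a τ : ℂ)) :=
    (integrable_indicator_iff measurableSet_Ioi).2
      (integrableOn_besselKernel (by simpa using hy) ha)
  have hcont : ContinuousAt ((Ioi (0 : ℝ)).indicator
      fun τ : ℝ ↦ cexp (-y * τ) * (besselKernel a τ : ℂ)) t := by
    have : ContinuousAt (fun τ : ℝ ↦ cexp (-y * τ) * (besselKernel a τ : ℂ)) t :=
      ContinuousAt.mul (by fun_prop)
        (continuous_ofReal.continuousAt.comp (continuousAt_besselKernel a ht))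
    refine this.congr ?_
    filter_upwards [Ioi_mem_nhds ht] with τ hτ
    rw [indicator_of_mem hτ]
  have key := hker.fourierInv_fourier_eq (by rw [hF]; exact hInt) hcont
  rw [indicator_of_mem (mem_Ioi.2 ht), hF, Real.fourierInv_eq'] at key
  have h := Measure.integral_comp_mul_left
    (fun x : ℝ ↦ besselTransform a (y - x * I) * cexp ((y - x * I) * t)) (-(2 * Real.pi))
  have habs : |(-(2 * Real.pi))⁻¹| = (2 * Real.pi)⁻¹ := by
    rw [inv_neg, abs_neg, abs_of_pos (by positivity)]
  rw [habs] at h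
  have h2 : ∫ ξ : ℝ, besselTransform a (y - ((-(2 * Real.pi) * ξ : ℝ) : ℂ) * I) *
      cexp ((y - ((-(2 * Real.pi) * ξ : ℝ) : ℂ) * I) * t) = besselKernel a t := by
    calc _ = ∫ ξ : ℝ, cexp (y * t) * (cexp ((2 * Real.pi * inner ℝ ξ t : ℝ) * I) •
          besselTransform a (y + 2 * Real.pi * ξ * I)) := by
          congr 1
          ext ξ
          rw [← congrFun hcomp ξ, smul_eq_mul, ← mul_assoc, ← Complex.exp_add, mul_comm]
          congr 2
          simp
          ring
      _ = cexp (y * t) * (cexp (-y * t) * besselKernel a t) := by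
          rw [integral_const_mul]
          congr 1
      _ = _ := by
          rw [← mul_assoc, ← Complex.exp_add]
          simp
  rw [h2, real_smul] at h
  rw [h]
  have : (2 * Real.pi : ℂ) * ((2 * Real.pi)⁻¹ : ℝ) = 1 := by
    have : (Real.pi : ℂ) ≠ 0 := by simp [Real.pi_ne_zero]
    push_cast
    field_simp
  rw [← mul_assoc, this, one_mul]

theorem norm_besselTransform_le_of_abs_le {a y x : ℝ} (ha1 : a ^ 2 ≤ 1 / 3)
    (hx : 1 / 2 < |x|) : ‖besselTransform a (y - x * I)‖ ≤ a ^ 4 * |x| ^ (-(3 / 2) : ℝ) := by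
  set r := ‖(y - x * I : ℂ)‖ with hr
  have hxr : |x| ≤ r := by
    have := Complex.abs_im_le_norm (y - x * I : ℂ)
    simpa using this
  have hx0 : 0 < |x| := by linarith
  have hr0 : 0 < r := hx0.trans_le hxr
  have h : ‖(a ^ 2 / (y - x * I) : ℂ)‖ = a ^ 2 / r := by
    rw [norm_div, norm_pow, norm_real, Real.norm_eq_abs, sq_abs]
  have h1 : a ^ 2 / r ≤ 1 := by
    rw [div_le_one hr0]
    linarith
  rw [besselTransform, norm_mul, norm_cpow_half]
  have h2 := Complex.norm_exp_sub_one_sub_id_le (h.trans_le h1)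
  rw [h] at h2
  have h3 : |x| ^ (-(3 / 2) : ℝ) = (√|x| * |x|)⁻¹ := by
    rw [Real.sqrt_eq_rpow, ← Real.rpow_add_one hx0.ne', ← Real.rpow_neg hx0.le]
    norm_num
  have h4 : √r * (a ^ 2 / r) ^ 2 = a ^ 4 * (√r * r)⁻¹ := by
    have := Real.sq_sqrt hr0.le
    have h5 : √r ≠ 0 := (Real.sqrt_pos.2 hr0).ne'
    field_simp
    rw [this]
    ring
  calc _ ≤ √r * (a ^ 2 / r) ^ 2 := by gcongr
    _ ≤ _ := by
      rw [h3, h4]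
      gcongr

theorem norm_integral_Ioi_le {f : ℝ → ℂ} {C : ℝ} (hC : 0 ≤ C)
    (hf : ∀ x, 1 / 2 < x → ‖f x‖ ≤ C * x ^ (-(3 / 2) : ℝ)) :
    ‖∫ x in Ioi (1 / 2 : ℝ), f x‖ ≤ 3 * C := by
  have h := norm_integral_le_of_norm_le (μ := volume.restrict (Ioi (1 / 2 : ℝ)))
    ((integrableOn_Ioi_rpow_of_lt (by norm_num : (-(3 / 2) : ℝ) < -1)
      (by norm_num : (0 : ℝ) < 1 / 2)).const_mul C)
    ((ae_restrict_iff' measurableSet_Ioi).2 (ae_of_all _ hf))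
  rw [integral_const_mul, integral_Ioi_rpow_of_lt (by norm_num) (by norm_num)] at h
  refine h.trans ?_
  have h1 : (1 / 2 : ℝ) ^ (-(3 / 2) + 1 : ℝ) = √2 := by
    rw [Real.sqrt_eq_rpow, one_div, Real.inv_rpow (by norm_num), ← Real.rpow_neg (by norm_num)]
    norm_num
  have h2 : √2 ≤ 3 / 2 := by
    rw [Real.sqrt_le_iff]
    norm_num
  rw [h1]
  have : -√2 / (-(3 / 2) + 1) = 2 * √2 := by ring
  rw [this]
  nlinarith

theorem norm_cexp_mul_ofReal (y x t : ℝ) :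
    ‖cexp ((y - x * I) * t)‖ = Real.exp (y * t) := by
  rw [Complex.norm_exp]
  simp

theorem norm_integral_besselTransform_sub_le {a y t : ℝ} (ha : 0 ≤ a) (ha1 : a ^ 2 ≤ 1 / 3)
    (hy : 0 < y) (hy1 : y ≤ 1) (ht : 0 < t) :
    ‖(∫ x : ℝ in (-(1 / 2))..(1 / 2), besselTransform a (y - x * I) * cexp ((y - x * I) * t)) -
      2 * Real.pi * besselKernel a t‖ ≤ Real.exp (y * t) := by
  set f := fun x : ℝ ↦ besselTransform a (y - x * I) * cexp ((y - x * I) * t) with hf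
  have hInt : Integrable f :=
    (integrable_besselTransform a hy hy1).mul_bdd (c := Real.exp (y * t))
      (by fun_prop) (ae_of_all _ fun x ↦ (norm_cexp_mul_ofReal y x t).le)
  have hbound : ∀ x : ℝ, 1 / 2 < |x| →
      ‖f x‖ ≤ a ^ 4 * Real.exp (y * t) * |x| ^ (-(3 / 2) : ℝ) := fun x hx ↦ by
    rw [hf, norm_mul, norm_cexp_mul_ofReal, mul_right_comm]
    gcongr
    exact norm_besselTransform_le_of_abs_le ha1 hx
  have hC : 0 ≤ a ^ 4 * Real.exp (y * t) := by positivity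
  have h1 : ‖∫ x in Ioi (1 / 2 : ℝ), f x‖ ≤ 3 * (a ^ 4 * Real.exp (y * t)) :=
    norm_integral_Ioi_le hC fun x hx ↦ by
      have hx0 : |x| = x := abs_of_pos (by linarith)
      have := hbound x (by rwa [hx0])
      rwa [hx0] at this
  have h2 : ‖∫ x in Iic (-(1 / 2) : ℝ), f x‖ ≤ 3 * (a ^ 4 * Real.exp (y * t)) := by
    rw [← integral_comp_neg_Ioi]
    refine norm_integral_Ioi_le hC fun x hx ↦ ?_
    have hx0 : |-x| = x := by rw [abs_neg, abs_of_pos (by linarith)]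
    have := hbound (-x) (by rwa [hx0])
    rwa [hx0] at this
  have h3 := intervalIntegral.integral_Iic_add_Ioi (b := (-(1 / 2) : ℝ)) hInt.integrableOn
    hInt.integrableOn
  have h4 := intervalIntegral.integral_interval_add_Ioi (a := (-(1 / 2) : ℝ)) (b := 1 / 2)
    hInt.integrableOn hInt.integrableOn
  rw [integral_besselTransform ha hy hy1 ht, ← h4] at h3
  rw [← h3, show ∀ p q r : ℂ, p - (q + (p + r)) = -(q + r) by intros; ring, norm_neg]
  refine (norm_add_le _ _).trans ((add_le_add h2 h1).trans ?_)
  nlinarith [Real.exp_pos (y * t), show a ^ 4 ≤ 1 / 9 by nlinarith [sq_nonneg a]]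

theorem norm_cpow_mul_one_add_le {a y x : ℝ} (hx : |x| ≤ 1 / 2) (hy : 0 < y) (hy1 : y ≤ 1 / 2) :
    ‖(y - x * I : ℂ) ^ (1 / 2 : ℂ) * (1 + a ^ 2 / (y - x * I))‖ ≤ 1 + a ^ 2 / √y := by
  set r := ‖(y - x * I : ℂ)‖ with hr
  have hyr : y ≤ r := by
    have := Complex.re_le_norm (y - x * I : ℂ)
    rwa [re_sub_mul_I] at this
  have hr0 : 0 < r := hy.trans_le hyr
  have hr1 : r ≤ 1 := by
    refine le_of_sq_le_sq ?_ zero_le_one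
    rw [hr, sq_norm_sub_mul_I, ← sq_abs x]
    nlinarith [abs_nonneg x]
  have h : ‖(1 + a ^ 2 / (y - x * I) : ℂ)‖ ≤ 1 + a ^ 2 / r := by
    refine (norm_add_le _ _).trans_eq ?_
    rw [norm_one, norm_div, norm_pow, norm_real, Real.norm_eq_abs, sq_abs]
  rw [norm_mul, norm_cpow_half]
  have hs : 0 < √r := Real.sqrt_pos.2 hr0
  have hs1 : √r ≤ 1 := Real.sqrt_le_one.2 hr1
  calc _ ≤ √r * (1 + a ^ 2 / r) := by gcongr
    _ = √r + a ^ 2 / √r := by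
      have := Real.sq_sqrt hr0.le
      field_simp
      rw [this]
    _ ≤ _ := by gcongr

theorem norm_integral_cpow_mul_cexp_sub_le {a y t : ℝ} (ha : 0 ≤ a) (ha1 : a ^ 2 ≤ 1 / 3)
    (hy : 0 < y) (hy1 : y ≤ 1 / 2) (ht : 0 < t) :
    ‖(∫ x : ℝ in (-(1 / 2))..(1 / 2), (y - x * I : ℂ) ^ (1 / 2 : ℂ) *
      cexp (a ^ 2 / (y - x * I)) * cexp ((y - x * I) * t)) -
      2 * Real.pi * besselKernel a t‖ ≤ Real.exp (y * t) * (2 + a ^ 2 / √y) := by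
  have h0 : ∀ x : ℝ, (y - x * I : ℂ) ≠ 0 := fun x h ↦ by
    have := re_sub_mul_I y x
    rw [h] at this
    simp at this
    exact hy.ne this
  have hc : Continuous fun x : ℝ ↦ (y - x * I : ℂ) ^ (1 / 2 : ℂ) *
      (1 + a ^ 2 / (y - x * I)) * cexp ((y - x * I) * t) := by
    have h1 : Continuous fun x : ℝ ↦ (a ^ 2 / (y - x * I) : ℂ) :=
      Continuous.div continuous_const (by fun_prop) h0
    have h2 : Continuous fun x : ℝ ↦ (y - x * I : ℂ) ^ (1 / 2 : ℂ) :=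
      Continuous.cpow (by fun_prop) continuous_const fun x ↦ Or.inl (by rwa [re_sub_mul_I])
    fun_prop
  have hc2 : Continuous fun x : ℝ ↦ besselTransform a (y - x * I) * cexp ((y - x * I) * t) :=
    (continuous_besselTransform a hy).mul (by fun_prop)
  have hsplit : (fun x : ℝ ↦ (y - x * I : ℂ) ^ (1 / 2 : ℂ) *
      cexp (a ^ 2 / (y - x * I)) * cexp ((y - x * I) * t)) = fun x : ℝ ↦
      besselTransform a (y - x * I) * cexp ((y - x * I) * t) +
      (y - x * I : ℂ) ^ (1 / 2 : ℂ) * (1 + a ^ 2 / (y - x * I)) * cexp ((y - x * I) * t) := by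
    ext x
    rw [besselTransform]
    ring
  have hb := intervalIntegral.norm_integral_le_of_norm_le_const (a := (-(1 / 2) : ℝ)) (b := 1 / 2)
    (f := fun x : ℝ ↦ (y - x * I : ℂ) ^ (1 / 2 : ℂ) * (1 + a ^ 2 / (y - x * I)) *
      cexp ((y - x * I) * t)) (C := (1 + a ^ 2 / √y) * Real.exp (y * t)) (fun x hx ↦ by
      rw [uIoc_of_le (by norm_num)] at hx
      rw [norm_mul, norm_cexp_mul_ofReal]
      gcongr
      exact norm_cpow_mul_one_add_le (abs_le.2 ⟨hx.1.le, hx.2⟩) hy hy1)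
  rw [hsplit, intervalIntegral.integral_add (hc2.intervalIntegrable _ _)
    (hc.intervalIntegrable _ _), add_sub_right_comm]
  refine (norm_add_le _ _).trans ?_
  have h1 := norm_integral_besselTransform_sub_le ha ha1 hy (by linarith) ht
  have h2 : |(1 / 2 : ℝ) - -(1 / 2)| = 1 := by norm_num
  rw [h2, mul_one] at hb
  linarith

theorem norm_integral_le_add_of_norm_le_ite {f : ℝ → ℂ} (hf : Continuous f) {δ c₁ c₂ : ℝ}
    (hδ : 0 ≤ δ) (hδ1 : δ ≤ 1 / 2) (hc : 0 ≤ c₂)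
    (h : ∀ x, |x| ≤ 1 / 2 → ‖f x‖ ≤ c₁ + if 1 / 2 - |x| < δ then c₂ else 0) :
    ‖∫ x in (-(1 / 2))..(1 / 2), f x‖ ≤ c₁ + 2 * δ * c₂ := by
  have hi : ∀ u v : ℝ, IntervalIntegrable f volume u v := fun u v ↦ hf.intervalIntegrable u v
  have hle : ∀ x, |x| ≤ 1 / 2 → ‖f x‖ ≤ c₁ + c₂ := fun x hx ↦ by
    have := h x hx
    split_ifs at this <;> linarith
  have h1 := intervalIntegral.norm_integral_le_of_norm_le_const (f := f) (C := c₁ + c₂)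
    (a := (-(1 / 2) : ℝ)) (b := -(1 / 2) + δ) (fun x hx ↦ by
      rw [uIoc_of_le (by linarith)] at hx
      exact hle x (abs_le.2 ⟨hx.1.le, by linarith [hx.2]⟩))
  have h2 := intervalIntegral.norm_integral_le_of_norm_le_const (f := f) (C := c₁)
    (a := (-(1 / 2) + δ : ℝ)) (b := 1 / 2 - δ) (fun x hx ↦ by
      rw [uIoc_of_le (by linarith)] at hx
      have hx1 : |x| ≤ 1 / 2 - δ := abs_le.2 ⟨by linarith [hx.1], hx.2⟩
      have := h x (by linarith)
      rwa [if_neg (by linarith), add_zero] at this)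
  have h3 := intervalIntegral.norm_integral_le_of_norm_le_const (f := f) (C := c₁ + c₂)
    (a := (1 / 2 - δ : ℝ)) (b := 1 / 2) (fun x hx ↦ by
      rw [uIoc_of_le (by linarith)] at hx
      exact hle x (abs_le.2 ⟨by linarith [hx.1], hx.2⟩))
  rw [← intervalIntegral.integral_add_adjacent_intervals (hi _ (1 / 2 - δ)) (hi _ _),
    ← intervalIntegral.integral_add_adjacent_intervals (hi _ (-(1 / 2) + δ)) (hi _ _)]
  refine (norm_add_le _ _).trans ?_
  refine (add_le_add_left (norm_add_le _ _) _).trans ?_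
  rw [abs_of_nonneg (by linarith)] at h1 h2 h3
  linarith

theorem continuous_inv_eta {y : ℝ} (hy : 0 < y) :
    Continuous fun x : ℝ ↦ (ModularForm.eta (x + y * I))⁻¹ := by
  have hz (x : ℝ) : (x + y * I : ℂ) ∈ UpperHalfPlane.upperHalfPlaneSet := by
    simpa [UpperHalfPlane.upperHalfPlaneSet] using hy
  refine continuous_iff_continuousAt.2 fun x ↦ ContinuousAt.inv₀ ?_ (ModularForm.eta_ne_zero (hz x))
  exact ContinuousAt.comp (f := fun x : ℝ ↦ (x + y * I : ℂ)) (g := ModularForm.eta)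
    (ModularForm.differentiableAt_eta_of_mem_upperHalfPlaneSet (hz x)).continuousAt (by fun_prop)

theorem norm_partitionFn_sub_besselKernel_le {n : ℕ} (hn : 1 ≤ n) {y : ℝ} (hy : 0 < y)
    (hy1 : y ≤ 91 / 25000) :
    ‖(partitionFn n : ℂ) -
      2 * Real.pi * besselKernel (√(Real.pi / 12)) (2 * Real.pi * (n - 1 / 24))‖ ≤
      Real.exp (2 * Real.pi * (n - 1 / 24) * y) *
        (26 / 100 * (101 / 100 * Real.exp (25 * Real.pi / (1968 * y))) + 2 +
          2 * (4 / 5 * y) * (97 / 1000 * (101 / 100 * Real.exp (Real.pi / (48 * y)))) +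
          (2 + Real.pi / 12 / √y)) := by
  have hn1 : (1 : ℝ) ≤ n := by exact_mod_cast hn
  have hpi := Real.pi_pos
  have hA : √(Real.pi / 12) ^ 2 = Real.pi / 12 := Real.sq_sqrt (by positivity)
  have ht : 0 < 2 * Real.pi * ((n : ℝ) - 1 / 24) := by
    have : 0 < (n : ℝ) - 1 / 24 := by linarith
    positivity
  have hm := norm_integral_cpow_mul_cexp_sub_le (Real.sqrt_nonneg (Real.pi / 12))
    (by rw [hA]; linarith [Real.pi_lt_four]) hy (by linarith) ht
  rw [hA] at hm
  have hrot (x : ℝ) : (x + y * I : ℂ) = (y - x * I) * I := by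
    linear_combination (x : ℂ) * I_sq
  have hrew : (fun x : ℝ ↦ (y - x * I : ℂ) ^ (1 / 2 : ℂ) *
      cexp ((√(Real.pi / 12) : ℝ) ^ 2 / (y - x * I)) *
      cexp ((y - x * I) * (2 * Real.pi * ((n : ℝ) - 1 / 24) : ℝ))) =
      fun x : ℝ ↦ ((x + y * I) / I) ^ (1 / 2 : ℂ) * cexp (Real.pi * I / (12 * (x + y * I))) *
        cexp (-(2 * Real.pi * I * (n - 1 / 24 : ℝ) * (x + y * I))) := by
    ext x
    have h0 : (y - x * I : ℂ) ≠ 0 := fun h ↦ by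
      have := re_sub_mul_I y x
      rw [h] at this
      simp at this
      exact hy.ne this
    congr 2
    · congr 1
      rw [hrot]
      field_simp
    · congr 1
      rw [← ofReal_pow, hA, hrot]
      push_cast
      field_simp
    · rw [hrot]
      push_cast
      linear_combination (2 * Real.pi * (y - x * I) * (n - 1 / 24) : ℂ) * I_sq
  rw [hrew] at hm
  have hc1 : Continuous fun x : ℝ ↦ (ModularForm.eta (x + y * I))⁻¹ *
      cexp (-(2 * Real.pi * I * (n - 1 / 24 : ℝ) * (x + y * I))) :=
    (continuous_inv_eta hy).mul (by fun_prop)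
  have hc2 : Continuous fun x : ℝ ↦ ((x + y * I) / I) ^ (1 / 2 : ℂ) *
      cexp (Real.pi * I / (12 * (x + y * I))) *
      cexp (-(2 * Real.pi * I * (n - 1 / 24 : ℝ) * (x + y * I))) := by
    have h0 : ∀ x : ℝ, (12 * (x + y * I) : ℂ) ≠ 0 := fun x h ↦ by
      have := congrArg Complex.im h
      simp at this
      exact hy.ne' this
    have h1 : Continuous fun x : ℝ ↦ (Real.pi * I / (12 * (x + y * I)) : ℂ) :=
      Continuous.div continuous_const (by fun_prop) h0
    have h2 : Continuous fun x : ℝ ↦ ((x + y * I) / I : ℂ) ^ (1 / 2 : ℂ) :=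
      Continuous.cpow (by fun_prop) continuous_const fun x ↦ Or.inl (by
        rw [hrot, mul_div_cancel_right₀ _ I_ne_zero]
        rwa [re_sub_mul_I])
    fun_prop
  have he := norm_integral_le_add_of_norm_le_ite (hc1.sub hc2) (δ := 4 / 5 * y)
    (c₁ := Real.exp (2 * Real.pi * (n - 1 / 24) * y) *
      (26 / 100 * (101 / 100 * Real.exp (25 * Real.pi / (1968 * y))) + 2))
    (c₂ := Real.exp (2 * Real.pi * (n - 1 / 24) * y) *
      (97 / 1000 * (101 / 100 * Real.exp (Real.pi / (48 * y))))) (by positivity) (by linarith)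
    (by positivity) (fun x hx ↦ by
      rw [Pi.sub_apply, ← sub_mul, norm_mul, norm_exp_neg_two_pi_I_mul_real, mul_comm,
        ← mul_ite_zero, ← mul_add]
      gcongr
      exact norm_inv_eta_sub_le_of_abs_le hx hy hy1)
  have hsub := intervalIntegral.integral_sub
    (hc1.intervalIntegrable (μ := volume) (-(1 / 2)) (1 / 2))
    (hc2.intervalIntegrable (-(1 / 2)) (1 / 2))
  rw [partitionFn_eq_integral n hy] at hsub
  simp only [Pi.sub_apply] at he
  rw [hsub] at he
  push_cast at he hm ⊢
  refine (norm_sub_le_norm_sub_add_norm_sub _ _ _).trans ((add_le_add he hm).trans_eq ?_)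
  ring_nf

end

theorem muP_sq {n : ℕ} (hn : 1 ≤ n) :
    muP n ^ 2 = Real.pi / 3 * (2 * Real.pi * (n - 1 / 24)) := by
  have hn1 : (1 : ℝ) ≤ n := by exact_mod_cast hn
  rw [muP, div_pow, mul_pow, Real.sq_sqrt (by linarith)]
  ring

theorem le_muP {n : ℕ} (hn : 789 ≤ n) : 72 ≤ muP n := by
  have hn1 : (789 : ℝ) ≤ n := by exact_mod_cast hn
  have h : 137.6 ≤ √(24 * (n : ℝ) - 1) := Real.le_sqrt_of_sq_le (by norm_num; linarith)
  rw [muP]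
  nlinarith [Real.pi_gt_d4]

theorem two_pi_mul_besselKernel {n : ℕ} (hn : 1 ≤ n) :
    2 * Real.pi * besselKernel (√(Real.pi / 12)) (2 * Real.pi * (n - 1 / 24)) =
      √12 * Real.pi ^ 2 / 36 * (2 * coshKernel (muP n)) / muP n ^ 3 := by
  have hpi := Real.pi_pos
  have hn1 : (1 : ℝ) ≤ n := by exact_mod_cast hn
  have hμ0 : 0 < muP n := by
    have : 0 < √(24 * (n : ℝ) - 1) := Real.sqrt_pos.2 (by linarith)
    rw [muP]
    positivity
  have hμ := muP_sq hn
  set t := 2 * Real.pi * ((n : ℝ) - 1 / 24) with ht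
  set m := muP n
  have htm : t = 3 * m ^ 2 / Real.pi := by
    rw [hμ]
    field_simp
  have h1 : 2 * √(Real.pi / 12) * √t = m := by
    rw [mul_assoc, ← Real.sqrt_mul (by positivity), htm,
      show Real.pi / 12 * (3 * m ^ 2 / Real.pi) = (m / 2) ^ 2 by field_simp; ring,
      Real.sqrt_sq (by positivity)]
    ring
  have h2 : √Real.pi * (t * √t) = 3 * m ^ 3 * √3 / Real.pi := by
    have : √Real.pi * √t = √3 * m := by
      rw [← Real.sqrt_mul hpi.le, htm, show Real.pi * (3 * m ^ 2 / Real.pi) = 3 * m ^ 2 by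
        field_simp, Real.sqrt_mul (by norm_num), Real.sqrt_sq hμ0.le]
    rw [mul_left_comm, this, htm]
    ring
  have h3 : √12 = 2 * √3 := by
    rw [show (12 : ℝ) = 2 ^ 2 * 3 by norm_num, Real.sqrt_mul (by norm_num),
      Real.sqrt_sq (by norm_num)]
  have h4 : √3 ^ 2 = 3 := Real.sq_sqrt (by norm_num)
  have h5 : 0 < √3 := Real.sqrt_pos.2 (by norm_num)
  rw [besselKernel, h1, mul_assoc 2 (√Real.pi), h2, h3]
  field_simp
  rw [h4]
  ring

theorem abs_two_mul_coshKernel_sub_le {m : ℝ} (hm : 2 ≤ m) :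
    |2 * coshKernel m - Real.exp m * (m - 1)| ≤ m ^ 2 := by
  have h : 2 * coshKernel m - Real.exp m * (m - 1) =
      2 - m ^ 2 - Real.exp (-m) * (m + 1) := by
    rw [coshKernel, Real.sinh_eq, Real.cosh_eq]
    ring
  have h1 : Real.exp (-m) * (m + 1) ≤ 1 := by
    rw [Real.exp_neg, inv_mul_le_one₀ (Real.exp_pos m)]
    exact Real.add_one_le_exp m
  have h2 : 0 ≤ Real.exp (-m) * (m + 1) := by positivity
  rw [h, abs_le]
  constructor <;> nlinarith

theorem exp_mul_le_exp_div {k m : ℝ} (hk : 0 < k) (hk1 : k ≤ 72) (hm : 72 ≤ m) :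
    Real.exp (72 / k) * (m / 72) ≤ Real.exp (m / k) := by
  have h : m / k = 72 / k + (m - 72) / k := by ring
  rw [h, Real.exp_add]
  have h1 := Real.add_one_le_exp ((m - 72) / k)
  have h2 : (m - 72) / 72 ≤ (m - 72) / k := by
    have : 0 ≤ m - 72 := by linarith
    gcongr
  gcongr
  linarith

theorem pow_le_exp_natCast (m : ℕ) : (271828 / 100000 : ℝ) ^ m ≤ Real.exp m := by
  rw [← Real.exp_one_pow]
  have := Real.exp_one_gt_d9
  gcongr
  linarith

theorem error_term_lt {m y : ℝ} (hm : 72 ≤ m) (hy : y = Real.pi / (12 * m)) :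
    Real.exp (m / 4) *
        (26 / 100 * (101 / 100 * Real.exp (25 * Real.pi / (1968 * y))) + 2 +
          2 * (4 / 5 * y) * (97 / 1000 * (101 / 100 * Real.exp (Real.pi / (48 * y)))) +
          (2 + Real.pi / 12 / √y)) + 1 < 82 / 100000 * Real.exp (m / 2) := by
  have hpi := Real.pi_pos
  have hm0 : 0 < m := by linarith
  have hy0 : 0 < y := by rw [hy]; positivity
  have hy1 : y ≤ 91 / 25000 := by
    rw [hy, div_le_iff₀ (by positivity)]
    linarith [Real.pi_lt_d4]
  have e1 : 25 * Real.pi / (1968 * y) = 25 * m / 164 := by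
    rw [hy]
    field_simp
    norm_num
  have e2 : Real.pi / (48 * y) = m / 4 := by
    rw [hy]
    field_simp
    norm_num
  have e3 : Real.pi / 12 / √y ≤ m := by
    have h : Real.pi / 12 = m * y := by rw [hy]; field_simp
    have h1 : √y ≤ 1 := Real.sqrt_le_one.2 (by linarith)
    have h2 := Real.sq_sqrt hy0.le
    have h3 := Real.sqrt_pos.2 hy0
    rw [h, div_le_iff₀ h3]
    gcongr
    nlinarith
  rw [e1, e2]
  set X := Real.exp (m / 2) with hX
  have hX0 : 0 < X := Real.exp_pos _
  have hE0 : 1 ≤ Real.exp (m / 4) := Real.one_le_exp (by positivity)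
  have hEE : Real.exp (m / 4) * Real.exp (m / 4) = X := by
    rw [← Real.exp_add, hX]
    ring_nf
  have hT1 : Real.exp (m / 4) * Real.exp (25 * m / 164) ≤ X / 1090 := by
    have h7 : (1090 : ℝ) ≤ Real.exp (16 * m / 164) :=
      le_trans (by norm_num) ((pow_le_exp_natCast 7).trans
        (Real.exp_le_exp.2 (by push_cast; linarith)))
    have h : Real.exp (m / 4) * Real.exp (25 * m / 164) * Real.exp (16 * m / 164) = X := by
      rw [← Real.exp_add, ← Real.exp_add, hX]
      ring_nf
    rw [le_div_iff₀ (by norm_num), ← h]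
    gcongr
  have hT3 : Real.exp (m / 4) * (5 + m) ≤ X / 200000 := by
    have h18 : (271828 / 100000 : ℝ) ^ 18 * (m / 72) ≤ Real.exp (m / 4) := by
      refine le_trans ?_ (exp_mul_le_exp_div (k := 4) (by norm_num) (by norm_num) hm)
      gcongr
      exact (pow_le_exp_natCast 18).trans_eq (congrArg Real.exp (by norm_num))
    rw [le_div_iff₀ (by norm_num), ← hEE, mul_assoc]
    gcongr
    norm_num at h18
    linarith
  calc _ ≤ Real.exp (m / 4) * (26 / 100 * (101 / 100 * Real.exp (25 * m / 164)) + 2 +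
          2 * (4 / 5 * (91 / 25000)) * (97 / 1000 * (101 / 100 * Real.exp (m / 4))) +
          (2 + m)) + Real.exp (m / 4) := by gcongr
    _ = 26 / 100 * (101 / 100) * (Real.exp (m / 4) * Real.exp (25 * m / 164)) +
        2 * (4 / 5 * (91 / 25000)) * (97 / 1000 * (101 / 100)) *
          (Real.exp (m / 4) * Real.exp (m / 4)) + Real.exp (m / 4) * (5 + m) := by ring
    _ ≤ 26 / 100 * (101 / 100) * (X / 1090) +
        2 * (4 / 5 * (91 / 25000)) * (97 / 1000 * (101 / 100)) * X + X / 200000 := by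
      rw [hEE]
      gcongr
    _ < _ := by linarith

theorem pow_ten_le_exp_half {m : ℝ} (hm : 72 ≤ m) : m ^ 10 ≤ 1000 * Real.exp (m / 2) := by
  have h := exp_mul_le_exp_div (k := 20) (by norm_num) (by norm_num) hm
  have h1 : (Real.exp (72 / 20) * (m / 72)) ^ 10 ≤ Real.exp (m / 20) ^ 10 := by gcongr
  rw [mul_pow, ← Real.exp_nat_mul, ← Real.exp_nat_mul] at h1
  have h2 : ((10 : ℕ) : ℝ) * (m / 20) = m / 2 := by push_cast; ring
  have h3 : ((10 : ℕ) : ℝ) * (72 / 20) = ((36 : ℕ) : ℝ) := by norm_num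
  rw [h2, h3] at h1
  have h4 : (271828 / 100000 : ℝ) ^ 36 * (m / 72) ^ 10 ≤ Real.exp (m / 2) := by
    refine le_trans ?_ h1
    gcongr
    exact pow_le_exp_natCast 36
  rw [div_pow] at h4
  have h5 : 0 < m ^ 10 := by positivity
  norm_num at h4
  linarith

theorem abs_partitionFn_sub_lt {n : ℕ} (hn : 789 ≤ n) :
    |(partitionFn n : ℝ) -
      √12 * Real.pi ^ 2 / 36 * (Real.exp (muP n) * (muP n - 1)) / muP n ^ 3| <
      √12 * Real.pi ^ 2 / 36 * Real.exp (muP n) / muP n ^ 10 := by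
  have hpi := Real.pi_pos
  have hm := le_muP hn
  have hsq := muP_sq (show 1 ≤ n by omega)
  have hk := two_pi_mul_besselKernel (show 1 ≤ n by omega)
  have hmain := norm_partitionFn_sub_besselKernel_le (show 1 ≤ n by omega)
    (y := Real.pi / (12 * muP n)) (by positivity) (by
      rw [div_le_iff₀ (by positivity)]
      linarith [Real.pi_lt_d4])
  set m := muP n
  have hm0 : 0 < m := by linarith
  have hyt : 2 * Real.pi * ((n : ℝ) - 1 / 24) * (Real.pi / (12 * m)) = m / 4 := by
    have : 2 * Real.pi * ((n : ℝ) - 1 / 24) = 3 * m ^ 2 / Real.pi := by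
      rw [hsq]
      field_simp
    rw [this]
    field_simp
    norm_num
  have herr := error_term_lt hm rfl
  rw [hyt] at hmain
  have hcast : ((partitionFn n : ℂ) - 2 * Real.pi *
      besselKernel (√(Real.pi / 12)) (2 * Real.pi * (n - 1 / 24))) =
      (((partitionFn n : ℝ) - 2 * Real.pi *
        besselKernel (√(Real.pi / 12)) (2 * Real.pi * (n - 1 / 24)) : ℝ) : ℂ) := by
    push_cast
    ring
  rw [hcast, Complex.norm_real, Real.norm_eq_abs, hk] at hmain
  set K := √12 * Real.pi ^ 2 / 36 with hK
  have hsqrt : √12 ^ 2 = 12 := Real.sq_sqrt (by norm_num)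
  have hs1 : 3.46 ≤ √12 := Real.le_sqrt_of_sq_le (by norm_num)
  have hs2 : √12 ≤ 3.5 := Real.sqrt_le_iff.2 (by norm_num)
  have hp1 : 9.8 ≤ Real.pi ^ 2 := by nlinarith [Real.pi_gt_d4]
  have hp2 : Real.pi ^ 2 ≤ 10 := by nlinarith [Real.pi_lt_d4]
  have hK1 : 9 / 10 ≤ K := by rw [hK]; nlinarith
  have hK2 : K ≤ 1 := by rw [hK]; nlinarith
  have hrem : |K * (2 * coshKernel m) / m ^ 3 - K * (Real.exp m * (m - 1)) / m ^ 3| ≤ 1 := by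
    have h := abs_two_mul_coshKernel_sub_le (show 2 ≤ m by linarith)
    rw [← sub_div, ← mul_sub, abs_div, abs_mul, abs_of_pos (by linarith : 0 < K),
      abs_of_pos (by positivity : 0 < m ^ 3), div_le_one (by positivity)]
    calc _ ≤ 1 * m ^ 2 := by gcongr
      _ ≤ m * m ^ 2 := by gcongr; linarith
      _ = m ^ 3 := by ring
  have hfin : 82 / 100000 * Real.exp (m / 2) ≤ K * Real.exp m / m ^ 10 := by
    have h := pow_ten_le_exp_half hm
    have hX : Real.exp m = Real.exp (m / 2) * Real.exp (m / 2) := by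
      rw [← Real.exp_add]
      ring_nf
    have hX0 := Real.exp_pos (m / 2)
    rw [le_div_iff₀ (by positivity), hX]
    calc _ ≤ 82 / 100000 * Real.exp (m / 2) * (1000 * Real.exp (m / 2)) := by gcongr
      _ = 82 / 100 * (Real.exp (m / 2) * Real.exp (m / 2)) := by ring
      _ ≤ _ := by gcongr; linarith
  have := abs_sub_le (partitionFn n : ℝ) (K * (2 * coshKernel m) / m ^ 3)
    (K * (Real.exp m * (m - 1)) / m ^ 3)
  linarith

theorem partition_bounds_l (n : ℕ) (hn : 789 ≤ n) :
    Real.sqrt 12 * Real.pi ^ 2 * Real.exp (muP n) / (36 * (muP n) ^ 10) *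
        ((muP n) ^ 8 - (muP n) ^ 7 - 1) < (partitionFn n : ℝ) ∧
    (partitionFn n : ℝ) <
      Real.sqrt 12 * Real.pi ^ 2 * Real.exp (muP n) / (36 * (muP n) ^ 10) *
        ((muP n) ^ 8 - (muP n) ^ 7 + 1) := by
  have h := abs_partitionFn_sub_lt hn
  have hm : 0 < muP n := by linarith [le_muP hn]
  have key (c : ℝ) : Real.sqrt 12 * Real.pi ^ 2 * Real.exp (muP n) / (36 * (muP n) ^ 10) *
      ((muP n) ^ 8 - (muP n) ^ 7 + c) =
      √12 * Real.pi ^ 2 / 36 * (Real.exp (muP n) * (muP n - 1)) / muP n ^ 3 +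
        c * (√12 * Real.pi ^ 2 / 36 * Real.exp (muP n) / muP n ^ 10) := by
    field_simp
  rw [sub_eq_add_neg (_ - _) (1 : ℝ), key, key]
  rw [abs_lt] at h
  constructor <;> linarith
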